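/- arXiv:1909.00776 — 6 statements merged into one kernel-verified Lean document; each statement's English description precedes it below -/
import Mathlib

section
/- Let T be a homeomorphism of a Polish space X, let ε > 0 and let n ≥ 1 be an integer. Then there exists a Borel subset B ⊆ X such that the sets T^j(B), 0 ≤ j < n, are pairwise disjoint, and μ(⋃_{0 ≤ j < n} T^j(B)) > 1 − ε for every aperiodic T-invariant Borel probability measure μ on X. -/
open MeasureTheory

/-- A set is `N`-separated for `T` if no point of it returns to it at a time `0 < j < N`. -/
def IsSeparatedFor {X : Type*} (T : X → X) (N : ℕ) (A : Set X) : Prop :=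
  ∀ x ∈ A, ∀ j, 0 < j → j < N → T^[j] x ∉ A

/-- Greedy union of a sequence of sets: a point of the next set is added when its orbit segment
at times `-N < j < N` does not meet the set built so far. -/
def greedyUnion {X : Type*} (T S : X → X) (N : ℕ) (U : ℕ → Set X) : ℕ → Set X
  | 0 => ∅
  | k + 1 => greedyUnion T S N U k ∪
      {x | x ∈ U k ∧ ∀ j < N, T^[j] x ∉ greedyUnion T S N U k ∧ S^[j] x ∉ greedyUnion T S N U k}

section GreedyUnion

variable {X : Type*} {T S : X → X} {N : ℕ} {U : ℕ → Set X}

theorem greedyUnion_mono : Monotone (greedyUnion T S N U) :=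
  monotone_nat_of_le_succ fun _ => Set.subset_union_left

theorem measurableSet_greedyUnion [MeasurableSpace X] (hT : Measurable T) (hS : Measurable S)
    (hU : ∀ k, MeasurableSet (U k)) (k : ℕ) : MeasurableSet (greedyUnion T S N U k) := by
  induction k with
  | zero => exact MeasurableSet.empty
  | succ k ih =>
    refine ih.union ?_
    simp only [Set.ofPred_and, Set.ofPred_forall]
    exact (hU k).inter (.iInter fun j => .iInter fun _ =>
      ((hT.iterate j) ih).compl.inter ((hS.iterate j) ih).compl)

theorem isSeparatedFor_greedyUnion (hST : Function.LeftInverse S T)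
    (hU : ∀ k, IsSeparatedFor T N (U k)) (k : ℕ) :
    IsSeparatedFor T N (greedyUnion T S N U k) := by
  induction k with
  | zero => exact fun x hx => hx.elim
  | succ k ih =>
    rintro x (hx | ⟨hxU, hx⟩) j hj0 hjN (hy | ⟨hyU, hy⟩)
    · exact ih x hx j hj0 hjN hy
    · apply (hy j hjN).2
      rwa [hST.iterate j x]
    · exact (hx j hjN).1 hy
    · exact hU k x hxU j hj0 hjN hyU

theorem isSeparatedFor_iUnion_greedyUnion (hST : Function.LeftInverse S T)
    (hU : ∀ k, IsSeparatedFor T N (U k)) :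
    IsSeparatedFor T N (⋃ k, greedyUnion T S N U k) := by
  intro x hx j hj0 hjN hy
  obtain ⟨k, hk⟩ := Set.mem_iUnion.1 hx
  obtain ⟨l, hl⟩ := Set.mem_iUnion.1 hy
  exact isSeparatedFor_greedyUnion hST hU (max k l) x (greedyUnion_mono (le_max_left k l) hk)
    j hj0 hjN (greedyUnion_mono (le_max_right k l) hl)

theorem exists_iterate_mem_iUnion_greedyUnion (hN : 0 < N) {k : ℕ} {x : X} (hx : x ∈ U k) :
    ∃ j < N, T^[j] x ∈ ⋃ k, greedyUnion T S N U k ∨ S^[j] x ∈ ⋃ k, greedyUnion T S N U k := by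
  by_contra! h
  have hmem : x ∈ greedyUnion T S N U (k + 1) :=
    Or.inr ⟨hx, fun j hj => ⟨fun hm => (h j hj).1 (Set.mem_iUnion_of_mem k hm),
      fun hm => (h j hj).2 (Set.mem_iUnion_of_mem k hm)⟩⟩
  exact (h 0 hN).1 (Set.mem_iUnion_of_mem (k + 1) hmem)

end GreedyUnion

theorem exists_isOpen_isSeparatedFor {X : Type*} [TopologicalSpace X] [T2Space X] {T : X → X}
    (hT : Continuous T) (N : ℕ) {x : X} (hx : ∀ k, 1 ≤ k → T^[k] x ≠ x) :
    ∃ V : Set X, IsOpen V ∧ x ∈ V ∧ IsSeparatedFor T N V := by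
  have key : ∀ j : ℕ, ∃ V : Set X, IsOpen V ∧ x ∈ V ∧ (0 < j → ∀ y ∈ V, T^[j] y ∉ V) := by
    intro j
    rcases Nat.eq_zero_or_pos j with rfl | hj
    · exact ⟨Set.univ, isOpen_univ, trivial, fun h => (lt_irrefl _ h).elim⟩
    · obtain ⟨V, W, hV, hW, hxV, hxW, hVW⟩ := t2_separation (hx j hj).symm
      refine ⟨V ∩ T^[j] ⁻¹' W, hV.inter (hW.preimage (hT.iterate j)), ⟨hxV, hxW⟩, ?_⟩
      exact fun _ y hy hy' => Set.disjoint_left.1 hVW hy'.1 hy.2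
  choose V hV hxV hsep using key
  refine ⟨⋂ j ∈ Finset.range N, V j, isOpen_biInter_finset fun j _ => hV j,
    Set.mem_iInter₂.2 fun j _ => hxV j, fun y hy j hj0 hjN hy' => ?_⟩
  have hj := Finset.mem_range.2 hjN
  exact hsep j hj0 y (Set.mem_iInter₂.1 hy j hj) (Set.mem_iInter₂.1 hy' j hj)

theorem exists_seq_isOpen_isSeparatedFor {X : Type*} [TopologicalSpace X] [T2Space X]
    [SecondCountableTopology X] {T : X → X} (hT : Continuous T) (N : ℕ) :
    ∃ U : ℕ → Set X, (∀ k, IsOpen (U k)) ∧ (∀ k, IsSeparatedFor T N (U k)) ∧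
      ∀ x, (∀ k, 1 ≤ k → T^[k] x ≠ x) → ∃ k, x ∈ U k := by
  let C : Set (Set X) :=
    insert ∅ {V | V ∈ TopologicalSpace.countableBasis X ∧ IsSeparatedFor T N V}
  have hC : C.Countable :=
    ((TopologicalSpace.countable_countableBasis X).mono fun _ h => h.1).insert ∅
  obtain ⟨U, hU⟩ := hC.exists_eq_range ⟨∅, Set.mem_insert _ _⟩
  have hUC : ∀ k, U k ∈ C := fun k => hU ▸ Set.mem_range_self k
  refine ⟨U, fun k => ?_, fun k => ?_, fun x hx => ?_⟩
  · rcases hUC k with h | h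
    · exact h ▸ isOpen_empty
    · exact TopologicalSpace.isOpen_of_mem_countableBasis h.1
  · rcases hUC k with h | h
    · rw [h]
      exact fun x hx => hx.elim
    · exact h.2
  · obtain ⟨V, hV, hxV, hsep⟩ := exists_isOpen_isSeparatedFor hT N hx
    obtain ⟨W, hW, hxW, hWV⟩ :=
      (TopologicalSpace.isBasis_countableBasis X).exists_subset_of_mem_open hxV hV
    have hWC : W ∈ C :=
      Or.inr ⟨hW, fun y hy j hj0 hjN hy' => hsep y (hWV hy) j hj0 hjN (hWV hy')⟩
    rw [hU] at hWC
    obtain ⟨k, rfl⟩ := hWC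
    exact ⟨k, hxW⟩

theorem Function.LeftInverse.iterate_apply_iterate_of_le {X : Type*} {S T : X → X}
    (h : Function.LeftInverse S T) {i m : ℕ} (him : i ≤ m) (x : X) :
    S^[i] (T^[m] x) = T^[m - i] x := by
  obtain ⟨d, rfl⟩ := Nat.exists_eq_add_of_le him
  rw [Function.iterate_add_apply, h.iterate i, Nat.add_sub_cancel_left]

/-- A Borel marker set: it is `N`-separated and meets every backward aperiodic orbit. -/
theorem exists_measurableSet_isSeparatedFor {X : Type*} [TopologicalSpace X] [T2Space X]
    [SecondCountableTopology X] [MeasurableSpace X] [BorelSpace X] (T : X ≃ₜ X) {N : ℕ}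
    (hN : 0 < N) :
    ∃ A : Set X, MeasurableSet A ∧ IsSeparatedFor T N A ∧
      ∀ x, (∀ k, 1 ≤ k → T^[k] x ≠ x) → ∃ i, T.symm^[i] x ∈ A := by
  obtain ⟨U, hUo, hUs, hUc⟩ := exists_seq_isOpen_isSeparatedFor T.continuous N
  have hST : Function.LeftInverse T.symm T := T.symm_apply_apply
  have hTS : Function.LeftInverse T T.symm := T.apply_symm_apply
  refine ⟨⋃ k, greedyUnion T T.symm N U k, MeasurableSet.iUnion fun k =>
    measurableSet_greedyUnion T.measurable T.symm.measurable (fun k => (hUo k).measurableSet) k,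
    isSeparatedFor_iUnion_greedyUnion hST hUs, fun x hx => ?_⟩
  have hy : ∀ k, 1 ≤ k → T^[k] (T.symm^[N] x) ≠ T.symm^[N] x := by
    intro k hk h
    apply hx k hk
    have := congrArg (T^[N]) h
    rwa [← Function.iterate_add_apply, add_comm, Function.iterate_add_apply,
      hTS.iterate N] at this
  obtain ⟨k, hk⟩ := hUc _ hy
  obtain ⟨j, hj, h | h⟩ := exists_iterate_mem_iUnion_greedyUnion (T := T) (S := T.symm) hN hk
  · rw [hTS.iterate_apply_iterate_of_le hj.le] at h
    exact ⟨_, h⟩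
  · rw [← Function.iterate_add_apply] at h
    exact ⟨_, h⟩

/-- The points whose last visit to `A` happened a multiple of `n` steps ago and which do not visit
`A` during the next `n - 1` steps. -/
def towerBase {X : Type*} (T S : X → X) (n : ℕ) (A : Set X) : Set X :=
  {x | (∃ m, S^[n * m] x ∈ A ∧ ∀ i < n * m, S^[i] x ∉ A) ∧ ∀ i, 1 ≤ i → i < n → T^[i] x ∉ A}

section TowerBase

variable {X : Type*} {T S : X → X} {n : ℕ} {A : Set X}

theorem measurableSet_towerBase [MeasurableSpace X] (hT : Measurable T) (hS : Measurable S)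
    (hA : MeasurableSet A) : MeasurableSet (towerBase T S n A) := by
  unfold towerBase
  simp only [Set.ofPred_and, Set.ofPred_exists, Set.ofPred_forall]
  refine .inter (.iUnion fun m => ((hS.iterate _) hA).inter ?_) ?_
  · exact .iInter fun i => .iInter fun _ => ((hS.iterate i) hA).compl
  · exact .iInter fun i => .iInter fun _ => .iInter fun _ => ((hT.iterate i) hA).compl

theorem iterate_notMem_towerBase (hST : Function.LeftInverse S T) {x : X}
    (hx : x ∈ towerBase T S n A) {d : ℕ} (hd0 : 0 < d) (hdn : d < n) :
    T^[d] x ∉ towerBase T S n A := by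
  rintro ⟨⟨m', hm', hlt'⟩, -⟩
  obtain ⟨⟨m, hm, hlt⟩, hfwd⟩ := hx
  have hback : ∀ e, S^[e + d] (T^[d] x) = S^[e] x := fun e => by
    rw [Function.iterate_add_apply, hST.iterate d]
  rcases lt_or_ge (n * m') d with h | h
  · rw [hST.iterate_apply_iterate_of_le h.le] at hm'
    exact hfwd _ (by omega) (by omega) hm'
  · obtain ⟨e, he⟩ := Nat.exists_eq_add_of_le' h
    rw [he, hback] at hm'
    have h1 : n * m ≤ e := not_lt.1 fun h => hlt e h hm'
    have h2 : e ≤ n * m := by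
      by_contra! h
      exact hlt' (n * m + d) (by omega) (by rwa [hback])
    have h3 : n ∣ d := (Nat.dvd_add_right (dvd_mul_right n m)).1
      ⟨m', by rw [he, le_antisymm h1 h2]⟩
    exact absurd (Nat.le_of_dvd hd0 h3) (not_le.2 hdn)

theorem disjoint_image_iterate_towerBase (hST : Function.LeftInverse S T) {j j' : ℕ}
    (hlt : j < j') (hj' : j' < n) :
    Disjoint (T^[j] '' towerBase T S n A) (T^[j'] '' towerBase T S n A) := by
  rw [Set.disjoint_left]
  rintro _ ⟨y, hy, rfl⟩ ⟨y', hy', h⟩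
  apply iterate_notMem_towerBase hST hy' (Nat.sub_pos_of_lt hlt) (by omega)
  rw [← hST.iterate_apply_iterate_of_le hlt.le, h, hST.iterate j]
  exact hy

theorem exists_mem_image_iterate_towerBase_or (hTS : Function.LeftInverse T S) (hn : 1 ≤ n)
    {x : X} (hx : ∃ i, S^[i] x ∈ A) :
    (∃ j < n, x ∈ T^[j] '' towerBase T S n A) ∨ ∃ i < n, T^[i] x ∈ A := by
  classical
  by_contra! h
  obtain ⟨hcov, hfwd⟩ := h
  set b := Nat.find hx
  have hq : b % n < n := Nat.mod_lt _ hn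
  have hdiv := Nat.div_add_mod b n
  refine hcov (b % n) hq ⟨S^[b % n] x, ⟨⟨b / n, ?_, fun i hi => ?_⟩, fun i hi1 hin => ?_⟩,
    hTS.iterate _ x⟩
  · rw [← Function.iterate_add_apply, hdiv]
    exact Nat.find_spec hx
  · rw [← Function.iterate_add_apply]
    exact Nat.find_min hx (by omega)
  · rcases le_total i (b % n) with hle | hle
    · rw [hTS.iterate_apply_iterate_of_le hle]
      exact Nat.find_min hx (by omega)
    · obtain ⟨e, rfl⟩ := Nat.exists_eq_add_of_le' hle
      rw [Function.iterate_add_apply, hTS.iterate]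
      exact hfwd e (by omega)

end TowerBase

theorem IsSeparatedFor.mul_measure_le_one {X : Type*} [MeasurableSpace X] {μ : Measure X}
    [IsProbabilityMeasure μ] {T : X → X} (hT : MeasurePreserving T μ μ) {N : ℕ} {A : Set X}
    (hA : MeasurableSet A) (hsep : IsSeparatedFor T N A) : N * μ A ≤ 1 := by
  have hlt : ∀ i j, i < j → j < N → Disjoint (T^[i] ⁻¹' A) (T^[j] ⁻¹' A) := by
    intro i j hij hj
    rw [Set.disjoint_left]
    intro x hx hx'
    apply hsep _ hx (j - i) (by omega) (by omega)
    rwa [← Function.iterate_add_apply, Nat.sub_add_cancel hij.le]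
  have hdisj : (Finset.range N : Set ℕ).PairwiseDisjoint fun j => T^[j] ⁻¹' A := by
    intro i hi j hj hij
    rcases hij.lt_or_gt with h | h
    · exact hlt i j h (by simpa using hj)
    · exact (hlt j i h (by simpa using hi)).symm
  have h := measure_biUnion_finset (μ := μ) hdisj fun j _ => (hT.iterate j).measurable hA
  simp only [(hT.iterate _).measure_preimage hA.nullMeasurableSet, Finset.sum_const,
    Finset.card_range, nsmul_eq_mul] at h
  exact h ▸ prob_le_one

/-- Borel version of Rokhlin's lemma (Glasner–Weiss): for a homeomorphism `T` of a
Polish space `X`, `ε > 0`, and `n ≥ 1`, there is a Borel set `B` whose images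
`T^j(B)`, `0 ≤ j < n`, are pairwise disjoint and whose union has measure `> 1 - ε`
for every aperiodic `T`-invariant Borel probability measure. -/
theorem borel_rokhlin_lemma (X : Type*) [TopologicalSpace X] [PolishSpace X]
    [MeasurableSpace X] [BorelSpace X]
    (T : X ≃ₜ X) (ε : ℝ) (hε : 0 < ε) (n : ℕ) (hn : 1 ≤ n) :
    ∃ B : Set X, MeasurableSet B ∧
      (∀ j j' : ℕ, j < n → j' < n → j ≠ j' →
        Disjoint ((⇑T)^[j] '' B) ((⇑T)^[j'] '' B)) ∧
      ∀ μ : Measure X, IsProbabilityMeasure μ →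
        (∀ A : Set X, MeasurableSet A → μ (⇑T ⁻¹' A) = μ A) →
        μ {x : X | ∃ k : ℕ, 1 ≤ k ∧ (⇑T)^[k] x = x} = 0 →
        μ (⋃ j ∈ Finset.range n, (⇑T)^[j] '' B) > 1 - ENNReal.ofReal ε := by
  obtain ⟨N, hN⟩ := exists_nat_gt (n / min ε 1)
  have hδ : 0 < min ε 1 := lt_min hε one_pos
  have hN0 : (0 : ℝ) < N := lt_of_le_of_lt (by positivity) hN
  have hnN : n < min ε 1 * N := by rwa [div_lt_iff₀' hδ] at hN
  obtain ⟨A, hA, hsep, hcov⟩ := exists_measurableSet_isSeparatedFor T (Nat.cast_pos.1 hN0)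
  have hST : Function.LeftInverse T.symm T := T.symm_apply_apply
  have hTS : Function.LeftInverse T T.symm := T.apply_symm_apply
  refine ⟨towerBase T T.symm n A, measurableSet_towerBase T.measurable T.symm.measurable hA,
    fun j j' hj hj' hne => ?_, fun μ _ hinv hper => ?_⟩
  · rcases hne.lt_or_gt with h | h
    · exact disjoint_image_iterate_towerBase hST h hj'
    · exact (disjoint_image_iterate_towerBase hST h hj).symm
  have hT : MeasurePreserving T μ μ :=
    ⟨T.measurable, Measure.ext fun s hs => by rw [Measure.map_apply T.measurable hs, hinv s hs]⟩
  set E := ⋃ j ∈ Finset.range n, (⇑T)^[j] '' towerBase T T.symm n A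
  have hsub : Set.univ ⊆ E ∪ ({x : X | ∃ k : ℕ, 1 ≤ k ∧ (⇑T)^[k] x = x} ∪
      ⋃ i ∈ Finset.range n, (⇑T)^[i] ⁻¹' A) := by
    intro x _
    by_cases hx : ∃ k : ℕ, 1 ≤ k ∧ (⇑T)^[k] x = x
    · exact Or.inr (Or.inl hx)
    · push Not at hx
      rcases exists_mem_image_iterate_towerBase_or hTS hn (hcov x hx) with
        ⟨j, hj, h⟩ | ⟨i, hi, h⟩
      · exact Or.inl (Set.mem_biUnion (Finset.mem_coe.2 (Finset.mem_range.2 hj)) h)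
      · exact Or.inr (Or.inr (Set.mem_biUnion (Finset.mem_coe.2 (Finset.mem_range.2 hi)) h))
  have hvisit : μ (⋃ i ∈ Finset.range n, (⇑T)^[i] ⁻¹' A) ≤ n * μ A := by
    refine (measure_biUnion_finset_le _ _).trans_eq ?_
    simp only [(hT.iterate _).measure_preimage hA.nullMeasurableSet, Finset.sum_const,
      Finset.card_range, nsmul_eq_mul]
  have hone : 1 ≤ μ E + n * μ A := by
    calc (1 : ENNReal) = μ Set.univ := measure_univ.symm
      _ ≤ μ E + (μ {x : X | ∃ k : ℕ, 1 ≤ k ∧ (⇑T)^[k] x = x} +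
          μ (⋃ i ∈ Finset.range n, (⇑T)^[i] ⁻¹' A)) :=
        (measure_mono hsub).trans
          ((measure_union_le _ _).trans (add_le_add_right (measure_union_le _ _) _))
      _ ≤ μ E + n * μ A := by rw [hper, zero_add]; gcongr
  have hsmall : (N : ℝ) * μ.real A ≤ 1 := by
    have := ENNReal.toReal_mono ENNReal.one_ne_top (hsep.mul_measure_le_one hT hA)
    simpa [measureReal_def] using this
  have hreal : 1 ≤ μ.real E + n * μ.real A := by
    have hA_top : n * μ A ≠ ⊤ := ENNReal.mul_ne_top (ENNReal.natCast_ne_top n) (measure_ne_top μ A)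
    have := ENNReal.toReal_mono (ENNReal.add_ne_top.2 ⟨measure_ne_top μ E, hA_top⟩) hone
    rw [ENNReal.toReal_add (measure_ne_top μ E) hA_top] at this
    simpa [measureReal_def] using this
  have hlt : n * μ.real A < min ε 1 := by
    have h : n * (N * μ.real A) ≤ n * 1 := by gcongr
    by_contra! hge
    nlinarith
  obtain ⟨hlt_ε, hlt_one⟩ := lt_min_iff.1 hlt
  rw [gt_iff_lt, ← ENNReal.ofReal_one, ← ENNReal.ofReal_sub _ hε.le,
    ← ofReal_measureReal (measure_ne_top μ E), ENNReal.ofReal_lt_ofReal_iff']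
  exact ⟨by linarith, by linarith⟩
end

section
/- Let T be a Borel automorphism of a Polish space X, let 𝔰 = {h₁, …, h_n} be a nontrivial primitive signature, and let ε > 0. Then there exist Borel subsets B₁, …, B_n ⊆ X such that: (1) all the sets T^j(B_i), 1 ≤ i ≤ n, 0 ≤ j < h_i, are pairwise disjoint; (2) T maps the set Y = ⋃_{i=1}^n ⋃_{0 ≤ j < h_i} T^j(B_i) bijectively onto itself; (3) for every aperiodic T-invariant Borel probability measure μ on X one has μ(Y) = 1 and ∑_{i=1}^n μ(B_i) < 1/2 + ε. -/
open MeasureTheory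

/-- `f` labels the positions `0, …, r - 1` of an interval of length `r` cut into consecutive blocks:
`f m = (i, j)` means that `m` is the `j`-th position of a block of length `h i`. -/
structure IsTiling {ι : Type*} (h : ι → ℕ) (r : ℕ) (f : ℕ → ι × ℕ) : Prop where
  zero : 0 < r → (f 0).2 = 0
  lt : ∀ m < r, (f m).2 < h (f m).1
  succ : ∀ m, m + 1 < r → f (m + 1) = ((f m).1, (f m).2 + 1) ∨
    ((f m).2 + 1 = h (f m).1 ∧ (f (m + 1)).2 = 0)
  last : ∀ m, m + 1 = r → (f m).2 + 1 = h (f m).1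

namespace IsTiling

variable {ι : Type*} {h : ι → ℕ}

lemma append {r s : ℕ} {f g : ℕ → ι × ℕ} (hf : IsTiling h r f) (hg : IsTiling h s g) :
    IsTiling h (r + s) (fun m => if m < r then f m else g (m - r)) where
  zero h0 := by
    rcases Nat.eq_zero_or_pos r with rfl | hr
    · simpa using hg.zero (by omega)
    · simpa [hr] using hf.zero hr
  lt m hm := by
    split_ifs with hmr
    · exact hf.lt m hmr
    · exact hg.lt _ (by omega)
  succ m hm := by
    rcases lt_trichotomy (m + 1) r with hmr | hmr | hmr
    · simpa [hmr, show m < r by omega] using hf.succ m hmr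
    · right
      have h1 := hf.last m hmr
      have h2 := hg.zero (by omega)
      simp [hmr, show m < r by omega, h1, h2]
    · have h1 := hg.succ (m - r) (by omega)
      rw [show m - r + 1 = m + 1 - r by omega] at h1
      simpa [show ¬ m < r by omega, show ¬ m + 1 < r by omega] using h1
  last m hm := by
    split_ifs with hmr
    · exact hf.last m (by omega)
    · exact hg.last _ (by omega)

lemma single (i : ι) : IsTiling h (h i) (fun m => (i, m)) where
  zero _ := rfl
  lt _ hm := hm
  succ _ _ := Or.inl rfl
  last _ hm := hm

lemma periodic (i : ι) (hi : 0 < h i) (q : ℕ) :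
    IsTiling h (h i * q) (fun m => (i, m % h i)) where
  zero _ := Nat.zero_mod _
  lt m _ := Nat.mod_lt m hi
  succ m _ := by
    rcases (Nat.succ_le_of_lt (Nat.mod_lt m hi)).eq_or_lt with hm | hm
    · right
      refine ⟨hm, ?_⟩
      dsimp only
      rw [Nat.add_mod_eq_ite]
      rcases Nat.lt_or_ge 1 (h i) with h1 | h1
      · rw [Nat.mod_eq_of_lt h1, if_pos hm.ge]
        omega
      · simp [show h i = 1 by omega, Nat.mod_one]
    · left
      have : (m + 1) % h i = m % h i + 1 := by
        rw [Nat.add_mod_eq_ite, Nat.mod_eq_of_lt (show 1 < h i by omega)]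
        split_ifs <;> omega
      simp [this]
  last m hm := by
    have h1 : m + 1 ≡ 0 [MOD h i] := by simp [hm, Nat.ModEq]
    have h2 : h i ∣ m % h i + 1 := by
      rw [← Nat.modEq_zero_iff_dvd]
      exact ((Nat.mod_modEq m (h i)).add_right 1).trans h1
    exact le_antisymm (Nat.mod_lt m hi) (Nat.le_of_dvd (Nat.succ_pos _) h2)

end IsTiling

/-- Long intervals can be tiled by blocks of lengths `h i` so that the blocks of length one
occupy only boundedly many initial positions. -/
lemma exists_isTiling {ι : Type*} [Fintype ι] (h : ι → ℕ) (hpos : ∀ i, 0 < h i)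
    (hprim : Finset.univ.gcd h = 1) (hnontriv : ∃ i, h i ≠ 1) :
    ∃ N C : ℕ, ∀ r, N ≤ r → ∃ f, IsTiling h r f ∧ ∀ m < r, h (f m).1 = 1 → m < C := by
  obtain ⟨i₁, hi₁⟩ := hnontriv
  by_cases hone : ∃ i, h i = 1
  · obtain ⟨i₀, hi₀⟩ := hone
    refine ⟨0, h i₁, fun r _ => ?_⟩
    have key := (IsTiling.periodic (h := h) i₀ (hpos i₀) (r % h i₁)).append
      (IsTiling.periodic (h := h) i₁ (hpos i₁) (r / h i₁))
    rw [hi₀, one_mul, Nat.mod_add_div] at key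
    refine ⟨_, key, fun m _ hm => ?_⟩
    have := Nat.mod_lt r (hpos i₁)
    split_ifs at hm with hlt
    · omega
    · exact absurd hm hi₁
  · obtain ⟨N, hN⟩ := Nat.exists_mem_closure_of_ge (Set.range h)
    have hgcd : Nat.setGcd (Set.range h) = 1 := by
      rw [← Nat.dvd_one, ← hprim]
      exact Finset.dvd_gcd fun i _ => Nat.setGcd_dvd_of_mem ⟨i, rfl⟩
    refine ⟨N, 0, fun r hr => ?_⟩
    have hmem := hN r hr (by simp [hgcd])
    have key : ∃ f, IsTiling h r f := by
      clear hr
      induction hmem using AddSubmonoid.closure_induction with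
      | mem x hx =>
        obtain ⟨i, rfl⟩ := hx
        exact ⟨_, IsTiling.single i⟩
      | zero => exact ⟨_, IsTiling.periodic i₁ (hpos i₁) 0⟩
      | add x y _ _ hx hy =>
        obtain ⟨f, hf⟩ := hx
        obtain ⟨g, hg⟩ := hy
        exact ⟨_, hf.append hg⟩
    obtain ⟨f, hf⟩ := key
    exact ⟨f, hf, fun m _ hm => absurd ⟨_, hm⟩ hone⟩

section Towers

variable {X ι : Type*} {T : Equiv.Perm X} {Z : Set X} {h : ι → ℕ} {c : X → ι × ℕ}

/-- The label `c` describes `Z` as a union of towers over the sets `{c = (i, 0)}`. -/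
lemma image_iterate_base (hZ : ∀ x, T x ∈ Z ↔ x ∈ Z)
    (hsucc : ∀ x ∈ Z, c (T x) = ((c x).1, (c x).2 + 1) ∨
      ((c x).2 + 1 = h (c x).1 ∧ (c (T x)).2 = 0))
    (i : ι) (j : ℕ) (hj : j < h i) :
    (⇑T)^[j] '' {x | x ∈ Z ∧ c x = (i, 0)} = {x | x ∈ Z ∧ c x = (i, j)} := by
  induction j with
  | zero => simp
  | succ j ih =>
    rw [Function.iterate_succ', Set.image_comp, ih (by omega)]
    ext y
    constructor
    · rintro ⟨x, ⟨hx, hc⟩, rfl⟩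
      refine ⟨(hZ x).2 hx, ?_⟩
      rcases hsucc x hx with h1 | h1
      · simpa [hc] using h1
      · simp only [hc] at h1
        omega
    · rintro ⟨hy, hc⟩
      obtain ⟨x, rfl⟩ := T.surjective y
      have hx := (hZ x).1 hy
      refine ⟨x, ⟨hx, ?_⟩, rfl⟩
      rcases hsucc x hx with h1 | h1
      · rw [hc, Prod.mk.injEq] at h1
        ext
        · exact h1.1.symm
        · simp only
          omega
      · simp [hc] at h1

lemma biUnion_image_iterate_base (hZ : ∀ x, T x ∈ Z ↔ x ∈ Z)
    (hlt : ∀ x ∈ Z, (c x).2 < h (c x).1)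
    (hsucc : ∀ x ∈ Z, c (T x) = ((c x).1, (c x).2 + 1) ∨
      ((c x).2 + 1 = h (c x).1 ∧ (c (T x)).2 = 0)) :
    ⋃ i, ⋃ j ∈ Finset.range (h i), (⇑T)^[j] '' {x | x ∈ Z ∧ c x = (i, 0)} = Z := by
  ext y
  simp only [Set.mem_iUnion, Finset.mem_range, exists_prop]
  constructor
  · rintro ⟨i, j, hj, hy⟩
    rw [image_iterate_base hZ hsucc i j hj] at hy
    exact hy.1
  · intro hy
    refine ⟨(c y).1, (c y).2, hlt y hy, ?_⟩
    rw [image_iterate_base hZ hsucc _ _ (hlt y hy)]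
    exact ⟨hy, rfl⟩

end Towers

section Marker

variable {X : Type*}

lemma measurable_zpow_perm [MeasurableSpace X] {T : Equiv.Perm X} (hT : Measurable T)
    (hT' : Measurable T.symm) (k : ℤ) : Measurable ⇑(T ^ k) := by
  cases k with
  | ofNat k => exact hT.iterate k
  | negSucc k =>
    rw [zpow_negSucc, ← inv_pow]
    exact hT'.iterate (k + 1)

/-- Greedy maximal choice of points at mutual distance at least `N` along the orbits of `T`. -/
def greedyMarker (T : Equiv.Perm X) (N : ℕ) (U : ℕ → Set X) : ℕ → Set X
  | 0 => ∅
  | k + 1 => greedyMarker T N U k ∪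
      {x | x ∈ U k ∧ ∀ j : ℤ, |j| < N → (T ^ j) x ∉ greedyMarker T N U k}

lemma greedyMarker_mono (T : Equiv.Perm X) (N : ℕ) (U : ℕ → Set X) :
    Monotone (greedyMarker T N U) :=
  monotone_nat_of_le_succ fun _ => Set.subset_union_left

lemma measurableSet_greedyMarker [MeasurableSpace X] {T : Equiv.Perm X} (hT : Measurable T)
    (hT' : Measurable T.symm) (N : ℕ) {U : ℕ → Set X} (hU : ∀ k, MeasurableSet (U k)) (k : ℕ) :
    MeasurableSet (greedyMarker T N U k) := by
  induction k with
  | zero => exact MeasurableSet.empty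
  | succ k ih =>
    refine ih.union ((hU k).inter (?_ : MeasurableSet
      {x | ∀ j : ℤ, |j| < N → (T ^ j) x ∉ greedyMarker T N U k}))
    simp only [Set.ofPred_forall]
    exact MeasurableSet.iInter fun j => MeasurableSet.iInter fun _ =>
      (measurable_zpow_perm hT hT' j ih).compl

lemma greedyMarker_discrete {T : Equiv.Perm X} {N : ℕ} {U : ℕ → Set X}
    (hU : ∀ k, ∀ x ∈ U k, ∀ j : ℕ, 0 < j → j < N → (T ^ j) x ∉ U k) (k : ℕ) :
    ∀ x ∈ greedyMarker T N U k, ∀ j : ℕ, 0 < j → j < N → (T ^ j) x ∉ greedyMarker T N U k := by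
  induction k with
  | zero => exact fun x hx => hx.elim
  | succ k ih =>
    rintro x (hx | hx) j hj hjN (hy | hy)
    · exact ih x hx j hj hjN hy
    · refine hy.2 (-j) (by rw [abs_neg, Nat.abs_cast]; exact_mod_cast hjN) ?_
      rw [← Equiv.Perm.mul_apply, ← zpow_natCast T j, ← zpow_add]
      simpa using hx
    · refine hx.2 j (by rw [Nat.abs_cast]; exact_mod_cast hjN) ?_
      simpa using hy
    · exact hU k x hx.1 j hj hjN hy.1

/-- A measurable set meeting the orbit of every aperiodic point with bounded gaps, while returns
to it take at least `N` steps. -/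
lemma exists_marker [MeasurableSpace X] [TopologicalSpace X] [SecondCountableTopology X] [T1Space X]
    [OpensMeasurableSpace X] {T : Equiv.Perm X} (hT : Measurable T) (hT' : Measurable T.symm)
    (N : ℕ) :
    ∃ A : Set X, MeasurableSet A ∧
      (∀ x ∈ A, ∀ j : ℕ, 0 < j → j < N → (T ^ j) x ∉ A) ∧
      ∀ x, (∀ k : ℕ, 1 ≤ k → (T ^ k) x ≠ x) → ∃ j : ℤ, |j| ≤ N ∧ (T ^ j) x ∈ A := by
  obtain ⟨V, hV⟩ := ((TopologicalSpace.countable_countableBasis X).insert ∅).exists_eq_range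
    (Set.insert_nonempty _ _)
  have hVbasis := TopologicalSpace.isBasis_countableBasis X
  have hVopen : ∀ k, IsOpen (V k) := fun k => by
    rcases hV.ge (Set.mem_range_self k) with hk | hk
    · rw [hk]
      exact isOpen_empty
    · exact hVbasis.isOpen hk
  set U : ℕ → Set X := fun k => {x | x ∈ V k ∧ ∀ j : ℕ, 0 < j → j < N → (T ^ j) x ∉ V k}
  have hUmeas : ∀ k, MeasurableSet (U k) := fun k => by
    refine (hVopen k).measurableSet.inter (?_ : MeasurableSet
      {x | ∀ j : ℕ, 0 < j → j < N → (T ^ j) x ∉ V k})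
    simp only [Set.ofPred_forall]
    exact MeasurableSet.iInter fun j => MeasurableSet.iInter fun _ => MeasurableSet.iInter fun _ =>
      (hT.iterate j (hVopen k).measurableSet).compl
  have hUdisc : ∀ k, ∀ x ∈ U k, ∀ j : ℕ, 0 < j → j < N → (T ^ j) x ∉ U k :=
    fun k x hx j hj hjN hy => hx.2 j hj hjN hy.1
  refine ⟨⋃ k, greedyMarker T N U k,
    MeasurableSet.iUnion (measurableSet_greedyMarker hT hT' N hUmeas), ?_, ?_⟩
  · intro x hx j hj hjN hy
    obtain ⟨k, hk⟩ := Set.mem_iUnion.1 hx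
    obtain ⟨l, hl⟩ := Set.mem_iUnion.1 hy
    have hmono := greedyMarker_mono T N U
    exact greedyMarker_discrete hUdisc (max k l) x (hmono (le_max_left k l) hk) j hj hjN
      (hmono (le_max_right k l) hl)
  · intro x hx
    have hfin : ((fun j : ℕ => (T ^ j) x) '' Set.Ioo 0 N).Finite := (Set.finite_Ioo 0 N).image _
    have hxmem : x ∈ ((fun j : ℕ => (T ^ j) x) '' Set.Ioo 0 N)ᶜ := by
      rintro ⟨j, hj, hjx⟩
      exact hx j hj.1 hjx
    obtain ⟨v, hv, hxv, hsub⟩ := hVbasis.exists_subset_of_mem_open hxmem hfin.isClosed.isOpen_compl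
    obtain ⟨k, rfl⟩ := hV.le (Set.mem_insert_of_mem ∅ hv)
    have hxU : x ∈ U k := ⟨hxv, fun j hj hjN hy => hsub hy ⟨j, ⟨hj, hjN⟩, rfl⟩⟩
    by_cases hnear : ∃ j : ℤ, |j| < N ∧ (T ^ j) x ∈ greedyMarker T N U k
    · obtain ⟨j, hj, hjx⟩ := hnear
      exact ⟨j, hj.le, Set.mem_iUnion.2 ⟨k, hjx⟩⟩
    · refine ⟨0, by simp, Set.mem_iUnion.2 ⟨k + 1, Or.inr ⟨by simpa using hxU, ?_⟩⟩⟩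
      push Not at hnear
      simpa using hnear

end Marker

/-- Labelling of the points of `Z` obtained by tiling the orbit segments between consecutive
visits to `A`. -/
lemma exists_label {X ι : Type*} [MeasurableSpace X] {T : Equiv.Perm X} (hT : Measurable T)
    (hT' : Measurable T.symm) {Z A : Set X} (hZm : MeasurableSet Z) (hA : MeasurableSet A)
    (hZ : ∀ x, T x ∈ Z ↔ x ∈ Z) {N N₀ C : ℕ} {h : ι → ℕ} {F : ℕ → ℕ → ι × ℕ}
    (hN : N₀ ≤ N)
    (hF : ∀ r, N₀ ≤ r → IsTiling h r (F r) ∧ ∀ m < r, h (F r m).1 = 1 → m < C)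
    (hdisc : ∀ x ∈ A, ∀ j : ℕ, 0 < j → j < N → (T ^ j) x ∉ A)
    (hgap : ∀ x ∈ Z, ∃ j : ℤ, |j| ≤ N ∧ (T ^ j) x ∈ A) :
    ∃ c : X → ι × ℕ, (∀ q, MeasurableSet {x | c x = q}) ∧
      (∀ x ∈ Z, (c x).2 < h (c x).1) ∧
      (∀ x ∈ Z, c (T x) = ((c x).1, (c x).2 + 1) ∨
        ((c x).2 + 1 = h (c x).1 ∧ (c (T x)).2 = 0)) ∧
      ∀ x ∈ Z, h (c x).1 = 1 → ∃ m < C, (T ^ (-(m : ℤ))) x ∈ A := by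
  classical
  have hZnat : ∀ (k : ℕ) x, (T ^ k) x ∈ Z ↔ x ∈ Z := by
    intro k
    induction k with
    | zero => simp
    | succ k ih =>
      intro x
      rw [pow_succ', Equiv.Perm.mul_apply, hZ, ih]
  have hZneg : ∀ (k : ℕ) x, (T ^ (-(k : ℤ))) x ∈ Z ↔ x ∈ Z := by
    intro k x
    rw [← hZnat k, ← zpow_natCast, ← Equiv.Perm.mul_apply, ← zpow_add]
    simp
  have hback : ∀ x, ∃ m : ℕ, x ∉ Z ∨ (T ^ (-(m : ℤ))) x ∈ A := by
    intro x
    by_cases hx : x ∈ Z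
    · obtain ⟨j, hj, hjA⟩ := hgap _ ((hZneg N x).2 hx)
      refine ⟨(N - j).toNat, Or.inr ?_⟩
      rw [← Equiv.Perm.mul_apply, ← zpow_add] at hjA
      rw [abs_le] at hj
      rwa [Int.toNat_of_nonneg (by omega), neg_sub, sub_eq_add_neg]
    · exact ⟨0, Or.inl hx⟩
  have hfwd : ∀ x, ∃ p : ℕ, 0 < p ∧ (x ∉ Z ∨ (T ^ (p : ℤ)) x ∈ A) := by
    intro x
    by_cases hx : x ∈ Z
    · obtain ⟨j, hj, hjA⟩ := hgap _ ((hZnat (N + 1) x).2 hx)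
      rw [abs_le] at hj
      refine ⟨(j + (N + 1 : ℕ)).toNat, by omega, Or.inr ?_⟩
      rw [← Equiv.Perm.mul_apply, ← zpow_natCast, ← zpow_add] at hjA
      rwa [Int.toNat_of_nonneg (by omega)]
    · exact ⟨1, one_pos, Or.inl hx⟩
  set b : X → ℕ := fun x => Nat.find (hback x)
  set p : X → ℕ := fun x => Nat.find (hfwd x)
  have hbm : Measurable b := measurable_find hback fun m =>
    hZm.compl.union (measurable_zpow_perm hT hT' _ hA)
  have hpm : Measurable p := measurable_find hfwd fun m =>
    (MeasurableSet.const _).inter (hZm.compl.union (measurable_zpow_perm hT hT' _ hA))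
  have hbA : ∀ x ∈ Z, (T ^ (-(b x : ℤ))) x ∈ A := fun x hx =>
    (Nat.find_spec (hback x)).resolve_left (not_not.2 hx)
  have hpA : ∀ x ∈ Z, (T ^ (p x : ℤ)) x ∈ A := fun x hx =>
    (Nat.find_spec (hfwd x)).2.resolve_left (not_not.2 hx)
  have hp0 : ∀ x, 0 < p x := fun x => (Nat.find_spec (hfwd x)).1
  have hlen : ∀ x ∈ Z, N₀ ≤ b x + p x := by
    intro x hx
    by_contra! hlt
    refine hdisc _ (hbA x hx) (b x + p x) (by have := hp0 x; omega) (by omega) ?_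
    rw [← Equiv.Perm.mul_apply, ← zpow_natCast, ← zpow_add]
    simpa using hpA x hx
  refine ⟨fun x => F (b x + p x) (b x), fun q => ?_, fun x hx => ?_, fun x hx => ?_,
    fun x hx h1 => ?_⟩
  · exact (hbm.prodMk hpm) (MeasurableSet.of_discrete (s := {a : ℕ × ℕ | F (a.1 + a.2) a.1 = q}))
  · exact (hF _ (hlen x hx)).1.lt _ (by have := hp0 x; omega)
  · have hTx := (hZ x).2 hx
    have hshift : ∀ k : ℤ, (T ^ k) (T x) = (T ^ (k + 1)) x := fun k => by
      rw [zpow_add_one, Equiv.Perm.mul_apply]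
    rcases (Nat.succ_le_of_lt (hp0 x)).eq_or_lt with hpx | hpx
    · right
      have hTA : T x ∈ A := by
        have := hpA x hx
        rw [← hpx] at this
        simpa using this
      have hb0 : b (T x) = 0 := (Nat.find_eq_zero _).2 (Or.inr (by simpa using hTA))
      refine ⟨(hF _ (hlen x hx)).1.last _ (by omega), ?_⟩
      have := (hF _ (hlen _ hTx)).1.zero (by have := hp0 (T x); omega)
      dsimp only
      rwa [hb0] at this ⊢
    · have hb1 : b (T x) = b x + 1 := by
        refine (Nat.find_eq_iff _).2 ⟨Or.inr ?_, fun m hm hmA => ?_⟩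
        · rw [hshift]
          simpa using hbA x hx
        · have hmA := hmA.resolve_left (not_not.2 hTx)
          rw [hshift] at hmA
          rcases m with _ | m
          · exact Nat.find_min (hfwd x) hpx ⟨one_pos, Or.inr (by simpa using hmA)⟩
          · refine Nat.find_min (hback x) (m := m) (show m < b x by omega) (Or.inr ?_)
            simpa using hmA
      have hp1 : p (T x) + 1 = p x := by
        have : p (T x) = p x - 1 := by
          refine (Nat.find_eq_iff _).2 ⟨⟨by omega, Or.inr ?_⟩, fun m hm hmA => ?_⟩
          · rw [hshift, Nat.cast_sub (by omega)]
            simpa using hpA x hx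
          · have hmA' := hmA.2.resolve_left (not_not.2 hTx)
            rw [hshift] at hmA'
            refine Nat.find_min (hfwd x) (m := m + 1) (show m + 1 < p x by omega)
              ⟨by omega, Or.inr ?_⟩
            simpa using hmA'
        omega
      have := (hF _ (hlen x hx)).1.succ (b x) (by omega)
      simpa only [hb1, show b x + 1 + p (T x) = b x + p x by omega] using this
  · exact ⟨b x, (hF _ (hlen x hx)).2 _ (by have := hp0 x; omega) h1, hbA x hx⟩

lemma measureReal_zpow_preimage {X : Type*} [MeasurableSpace X] {T : Equiv.Perm X}
    (hT : Measurable T) (hT' : Measurable T.symm) {μ : Measure X} (hμ : MeasurePreserving T μ μ)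
    {A : Set X} (hA : MeasurableSet A) (k : ℤ) : μ.real (⇑(T ^ k) ⁻¹' A) = μ.real A := by
  cases k with
  | ofNat k => exact (hμ.iterate k).measureReal_preimage hA.nullMeasurableSet
  | negSucc k =>
    rw [← (hμ.iterate (k + 1)).measureReal_preimage
      (measurable_zpow_perm hT hT' _ hA).nullMeasurableSet, ← Set.preimage_comp,
      Equiv.Perm.iterate_eq_pow, ← Equiv.Perm.coe_mul, ← zpow_natCast, ← zpow_add]
    simp [Int.negSucc_eq]

/-- A measurable set whose returns take at least `N` steps has measure at most `1 / N`. -/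
lemma nat_mul_measureReal_le_one {X : Type*} [MeasurableSpace X] {T : Equiv.Perm X}
    {μ : Measure X} [IsProbabilityMeasure μ] (hμ : MeasurePreserving T μ μ)
    {A : Set X} (hA : MeasurableSet A) {N : ℕ}
    (hdisc : ∀ x ∈ A, ∀ j : ℕ, 0 < j → j < N → (T ^ j) x ∉ A) : N * μ.real A ≤ 1 := by
  have key := sum_measureReal_le_measureReal_univ (μ := μ) (s := Finset.range N)
    (t := fun j => (⇑T)^[j] ⁻¹' A) (fun j _ => (hμ.iterate j).measurable hA)
    (by
      have hlt : ∀ a b : ℕ, a < b → b < N →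
          Disjoint ((⇑T)^[a] ⁻¹' A) ((⇑T)^[b] ⁻¹' A) := by
        intro a b hab hb
        rw [Set.disjoint_left]
        intro x hxa hxb
        refine hdisc _ hxa (b - a) (by omega) (by omega) ?_
        rw [← Equiv.Perm.iterate_eq_pow, ← Function.iterate_add_apply, Nat.sub_add_cancel hab.le]
        exact hxb
      intro a ha b hb hab
      rw [Finset.coe_range, Set.mem_Iio] at ha hb
      rcases lt_or_gt_of_ne hab with h1 | h1
      · exact hlt a b h1 hb
      · exact (hlt b a h1 ha).symm)
  simpa [(hμ.iterate _).measureReal_preimage hA.nullMeasurableSet] using key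

/-- The total measure of the bases of towers of heights `h i`, when the towers of height one lie
near the set `A`. -/
lemma two_mul_sum_measureReal_base_le {X ι : Type*} [Fintype ι] [MeasurableSpace X]
    {T : Equiv.Perm X} (hT : Measurable T) (hT' : Measurable T.symm) {μ : Measure X}
    [IsProbabilityMeasure μ] (hμ : MeasurePreserving T μ μ) {A : Set X} (hA : MeasurableSet A)
    {h : ι → ℕ} (hpos : ∀ i, 0 < h i) {B : ι → Set X} (hB : ∀ i, MeasurableSet (B i))
    (hdisj : ∀ i i' : ι, ∀ j j' : ℕ, j < h i → j' < h i' → (i, j) ≠ (i', j') →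
      Disjoint ((⇑T)^[j] '' B i) ((⇑T)^[j'] '' B i'))
    {C : ℕ} (hone : ∀ i, h i = 1 → ∀ x ∈ B i, ∃ m < C, (T ^ (-(m : ℤ))) x ∈ A) :
    2 * ∑ i, μ.real (B i) ≤ 1 + C * μ.real A := by
  classical
  have himage : ∀ (j : ℕ) i, (⇑T)^[j] '' B i = ⇑(T ^ (-(j : ℤ))) ⁻¹' B i := by
    intro j i
    rw [Equiv.Perm.iterate_eq_pow, zpow_neg, zpow_natCast]
    exact (T ^ j).image_eq_preimage_symm (B i)
  have htotal : ∑ i, (h i : ℝ) * μ.real (B i) ≤ 1 := by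
    have key := sum_measureReal_le_measureReal_univ (μ := μ)
      (s := Finset.univ.sigma fun i : ι => Finset.range (h i))
      (t := fun a => (⇑T)^[a.2] '' B a.1)
      (fun a _ => by
        rw [himage]
        exact measurable_zpow_perm hT hT' _ (hB _))
      (fun a ha b hb hab => by
        simp only [Finset.coe_sigma, Finset.coe_univ, Set.mem_sigma_iff, Set.mem_univ, true_and,
          Finset.coe_range, Set.mem_Iio] at ha hb
        refine hdisj _ _ _ _ ha hb fun heq => hab ?_
        obtain ⟨i, j⟩ := a
        obtain ⟨i', j'⟩ := b
        obtain ⟨rfl, rfl⟩ := Prod.mk.inj heq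
        rfl)
    rw [Finset.sum_sigma] at key
    simpa only [himage, measureReal_zpow_preimage hT hT' hμ (hB _), Finset.sum_const,
      Finset.card_range, nsmul_eq_mul, probReal_univ] using key
  have hones : ∑ i with h i = 1, μ.real (B i) ≤ C * μ.real A := by
    rw [← measureReal_biUnion_finset (fun i hi i' hi' hne => by
      simpa using hdisj i i' 0 0 (hpos i) (hpos i') (by simpa using hne)) (fun i _ => hB i)]
    calc μ.real (⋃ i ∈ Finset.univ.filter fun i => h i = 1, B i)
        ≤ μ.real (⋃ m ∈ Finset.range C, ⇑(T ^ (-(m : ℤ))) ⁻¹' A) := by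
          refine measureReal_mono (fun x hx => ?_) (measure_ne_top _ _)
          simp only [Finset.mem_filter, Finset.mem_univ, true_and, Set.mem_iUnion,
            exists_prop] at hx
          obtain ⟨i, hi, hx⟩ := hx
          obtain ⟨m, hm, hmA⟩ := hone i hi x hx
          exact Set.mem_biUnion (Finset.mem_coe.2 (Finset.mem_range.2 hm)) hmA
      _ ≤ ∑ m ∈ Finset.range C, μ.real (⇑(T ^ (-(m : ℤ))) ⁻¹' A) :=
          measureReal_biUnion_finset_le _ _
      _ = C * μ.real A := by
          simp only [measureReal_zpow_preimage hT hT' hμ hA, Finset.sum_const, Finset.card_range,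
            nsmul_eq_mul]
  rw [Finset.sum_filter] at hones
  have hcompare : 2 * ∑ i, μ.real (B i) ≤
      ∑ i, (h i : ℝ) * μ.real (B i) + ∑ i, if h i = 1 then μ.real (B i) else 0 := by
    rw [Finset.mul_sum, ← Finset.sum_add_distrib]
    refine Finset.sum_le_sum fun i _ => ?_
    split_ifs with hi
    · rw [hi]
      push_cast
      linarith
    · have h2 : (2 : ℝ) ≤ h i := by
        have := hpos i
        exact_mod_cast (show 2 ≤ h i by omega)
      rw [add_zero]
      exact mul_le_mul_of_nonneg_right h2 measureReal_nonneg
  linarith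

/-- Weakened Borel version of Rokhlin's lemma: given a Borel automorphism `T` of a
Polish space, a nontrivial primitive signature `{h 1, …, h n}`, and `ε > 0`, there
are Borel sets `B 1, …, B n` whose towers are full and pairwise disjoint, `T` is a
bijection on the union `Y` of the towers, and for every aperiodic `T`-invariant
Borel probability measure `μ` one has `μ(Y) = 1` and `∑ μ(B i) < 1/2 + ε`. -/
theorem weak_borel_rokhlin (X : Type*) [TopologicalSpace X] [PolishSpace X]
    [MeasurableSpace X] [BorelSpace X]
    (T : Equiv.Perm X) (hT : Measurable T) (hT' : Measurable T.symm)
    (n : ℕ) (hn : 0 < n) (h : Fin n → ℕ) (hpos : ∀ i, 0 < h i)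
    (hinj : Function.Injective h)
    (hprim : Finset.univ.gcd h = 1) (hnontriv : ∃ i, h i ≠ 1)
    (ε : ℝ) (hε : 0 < ε) :
    ∃ B : Fin n → Set X, (∀ i, MeasurableSet (B i)) ∧
      (∀ i i' : Fin n, ∀ j j' : ℕ, j < h i → j' < h i' → (i, j) ≠ (i', j') →
        Disjoint ((⇑T)^[j] '' B i) ((⇑T)^[j'] '' B i')) ∧
      Set.BijOn ⇑T (⋃ i, ⋃ j ∈ Finset.range (h i), (⇑T)^[j] '' B i)
        (⋃ i, ⋃ j ∈ Finset.range (h i), (⇑T)^[j] '' B i) ∧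
      ∀ μ : Measure X, IsProbabilityMeasure μ →
        (∀ A : Set X, MeasurableSet A → μ (⇑T ⁻¹' A) = μ A) →
        μ {x : X | ∃ k : ℕ, 1 ≤ k ∧ (⇑T)^[k] x = x} = 0 →
        μ (⋃ i, ⋃ j ∈ Finset.range (h i), (⇑T)^[j] '' B i) = 1 ∧
          ∑ i, μ (B i) < 1 / 2 + ENNReal.ofReal ε := by
  classical
  obtain ⟨N₀, C, hNC⟩ := exists_isTiling h hpos hprim hnontriv
  have hNC' : ∀ r, ∃ f, N₀ ≤ r → IsTiling h r f ∧ ∀ m < r, h (f m).1 = 1 → m < C := by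
    intro r
    by_cases hr : N₀ ≤ r
    · obtain ⟨f, hf⟩ := hNC r hr
      exact ⟨f, fun _ => hf⟩
    · exact ⟨fun _ => (⟨0, hn⟩, 0), fun hr' => absurd hr' hr⟩
  choose F hF using hNC'
  obtain ⟨N₁, hN₁⟩ := exists_nat_ge (C / ε)
  set N := max N₀ N₁
  have hCN : (C : ℝ) ≤ N * ε := by
    rw [div_le_iff₀ hε] at hN₁
    have : (N₁ : ℝ) ≤ N := by exact_mod_cast le_max_right N₀ N₁
    nlinarith
  obtain ⟨A, hA, hdisc, hgap⟩ := exists_marker hT hT' N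
  set Z : Set X := {x | ∀ k : ℕ, 1 ≤ k → (T ^ k) x ≠ x} with hZdef
  have hZm : MeasurableSet Z := by
    simp only [hZdef, Set.ofPred_forall]
    exact MeasurableSet.iInter fun k => MeasurableSet.iInter fun _ =>
      (measurableSet_eq_fun (hT.iterate k) measurable_id).compl
  have hZ : ∀ x, T x ∈ Z ↔ x ∈ Z := by
    intro x
    refine forall_congr' fun k => forall_congr' fun _ => not_congr ?_
    rw [← Equiv.Perm.mul_apply, ← pow_succ, pow_succ', Equiv.Perm.mul_apply, T.injective.eq_iff]
  obtain ⟨c, hcm, hlt, hsucc, hone⟩ :=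
    exists_label hT hT' hZm hA hZ (le_max_left N₀ N₁) hF hdisc hgap
  have hBm : ∀ i, MeasurableSet {x | x ∈ Z ∧ c x = (i, 0)} := fun i => hZm.inter (hcm _)
  have hdisj : ∀ i i' : Fin n, ∀ j j' : ℕ, j < h i → j' < h i' → (i, j) ≠ (i', j') →
      Disjoint ((⇑T)^[j] '' {x | x ∈ Z ∧ c x = (i, 0)})
        ((⇑T)^[j'] '' {x | x ∈ Z ∧ c x = (i', 0)}) := by
    intro i i' j j' hj hj' hne
    rw [image_iterate_base hZ hsucc i j hj, image_iterate_base hZ hsucc i' j' hj',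
      Set.disjoint_left]
    exact fun x hx hx' => hne (hx.2.symm.trans hx'.2)
  refine ⟨fun i => {x | x ∈ Z ∧ c x = (i, 0)}, hBm, hdisj, ?_, ?_⟩
  · rw [biUnion_image_iterate_base hZ hlt hsucc]
    refine ⟨fun x hx => (hZ x).2 hx, T.injective.injOn, fun y hy => ?_⟩
    obtain ⟨x, rfl⟩ := T.surjective y
    exact ⟨x, (hZ x).1 hy, rfl⟩
  · intro μ _ hinv haper
    have hμ : MeasurePreserving T μ μ :=
      ⟨hT, Measure.ext fun s hs => by rw [Measure.map_apply hT hs, hinv s hs]⟩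
    constructor
    · rw [biUnion_image_iterate_base hZ hlt hsucc, ← prob_compl_eq_zero_iff hZm]
      rw [← haper]
      congr 1
      ext x
      simp [hZdef, Equiv.Perm.iterate_eq_pow]
    · have hbound := two_mul_sum_measureReal_base_le hT hT' hμ hA hpos hBm hdisj
        (fun i hi x hx => hone x hx.1 (by rw [hx.2]; exact hi))
      have hNA := nat_mul_measureReal_le_one hμ hA hdisc
      have hCA : C * μ.real A ≤ ε := by
        nlinarith [measureReal_nonneg (μ := μ) (s := A)]
      have hreal : ∑ i, μ.real {x | x ∈ Z ∧ c x = (i, 0)} < 1 / 2 + ε := by linarith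
      calc ∑ i, μ {x | x ∈ Z ∧ c x = (i, 0)}
          = ENNReal.ofReal (∑ i, μ.real {x | x ∈ Z ∧ c x = (i, 0)}) := by
            rw [ENNReal.ofReal_sum_of_nonneg fun _ _ => measureReal_nonneg]
            simp
        _ < ENNReal.ofReal (1 / 2 + ε) :=
            (ENNReal.ofReal_lt_ofReal_iff (by positivity)).2 hreal
        _ = 1 / 2 + ENNReal.ofReal ε := by
            rw [ENNReal.ofReal_add (by norm_num) hε.le]
            simp
end

section
/- Let h₁ < h₂ < … < h_n be positive integers with gcd(h₁, …, h_n) = 1 and {h₁, …, h_n} ≠ {1}, and let ε > 0. Then there exists a positive integer N such that every integer m ≥ N can be written as m = ∑_{i=1}^n α_i h_i with nonnegative integers α₁, …, α_n satisfying α₁ h₁ < ε m. -/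
theorem Finset.exists_sum_mul_eq_one_of_gcd_eq_one {ι : Type*} (s : Finset ι) (h : ι → ℕ)
    (hs : s.gcd h = 1) : ∃ z : ι → ℤ, ∑ i ∈ s, (h i : ℤ) * z i = 1 := by
  obtain ⟨z, hz⟩ := s.gcd_eq_sum_mul fun i => (h i : ℤ)
  refine ⟨z, hz.symm.trans ?_⟩
  refine Int.eq_one_of_dvd_one Int.finsetGcd_nonneg (Int.natAbs_dvd.mp ?_)
  rw [← Nat.cast_one, Int.natCast_dvd_natCast, ← hs]
  exact Finset.dvd_gcd fun i hi => Int.natCast_dvd_natCast.mp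
    (Int.natAbs_dvd.mpr (Finset.gcd_dvd (f := fun i => (h i : ℤ)) hi))

/-- Every large enough `m` is a natural combination of a coprime family `h` in which all
coefficients but the one of a prescribed member `h j` are smaller than `h j`. -/
theorem Nat.exists_eq_sum_mul_of_gcd_eq_one {ι : Type*} [Fintype ι] (h : ι → ℕ)
    (hgcd : Finset.univ.gcd h = 1) (j : ι) (hj : 0 < h j) (m : ℕ)
    (hm : h j * ∑ i, h i ≤ m) :
    ∃ α : ι → ℕ, m = ∑ i, α i * h i ∧ ∀ i, i ≠ j → α i < h j := by
  classical
  obtain ⟨z, hz⟩ := Finset.univ.exists_sum_mul_eq_one_of_gcd_eq_one h hgcd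
  have hj' : (0 : ℤ) < h j := by exact_mod_cast hj
  have hβ (i : ι) : ∃ b : ℕ, b < h j ∧ (b : ℤ) ≡ m * z i [ZMOD h j] := by
    have h0 := Int.emod_nonneg (m * z i) hj'.ne'
    have h1 := Int.emod_lt_of_pos (m * z i) hj'
    refine ⟨(m * z i % h j).toNat, by omega, ?_⟩
    rw [Int.toNat_of_nonneg h0]
    exact Int.mod_modEq _ _
  choose β hlt hmod using hβ
  have hle : ∑ i, β i * h i ≤ m := by
    refine le_trans ?_ hm
    rw [Finset.mul_sum]
    exact Finset.sum_le_sum fun i _ => Nat.mul_le_mul_right _ (hlt i).le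
  have hsum : (∑ i, (β i * h i : ℤ)) ≡ m [ZMOD h j] := by
    have hm_eq : ∑ i, (m * z i * h i : ℤ) = m := by
      simp_rw [mul_assoc, mul_comm (z _)]
      rw [← Finset.mul_sum, hz, mul_one]
    rw [Int.modEq_iff_dvd]
    rw [← hm_eq, ← Finset.sum_sub_distrib]
    refine Finset.dvd_sum fun i _ => ?_
    rw [← sub_mul]
    exact (Int.modEq_iff_dvd.mp (hmod i)).mul_right _
  obtain ⟨q, hq⟩ : h j ∣ m - ∑ i, β i * h i :=
    (Nat.modEq_iff_dvd' hle).mp (Int.natCast_modEq_iff.mp (by exact_mod_cast hsum))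
  refine ⟨β + Pi.single j q, ?_, fun i hi => by simpa [hi] using hlt i⟩
  have hsingle : ∑ i, (Pi.single j q : ι → ℕ) i * h i = q * h j := by
    rw [Finset.sum_eq_single j (fun i _ hi => by simp [hi]) (by simp), Pi.single_eq_same]
  simp only [Pi.add_apply, add_mul, Finset.sum_add_distrib, hsingle]
  rw [mul_comm q, ← hq]
  omega

/-- Number-theoretic ingredient: if `h 0 < h 1 < … < h (n-1)` are positive integers
with gcd `1` and `{h 0, …, h (n-1)} ≠ {1}`, then for every `ε > 0` there is `N` such
that every `m ≥ N` can be written as `m = ∑ α i * h i` with `α 0 * h 0 < ε * m`. -/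
theorem signature_representation (n : ℕ) (hn : 0 < n) (h : Fin n → ℕ)
    (hpos : ∀ i, 0 < h i) (hmono : StrictMono h)
    (hprim : Finset.univ.gcd h = 1)
    (hnontriv : Finset.univ.image h ≠ {1})
    (ε : ℝ) (hε : 0 < ε) :
    ∃ N : ℕ, 0 < N ∧ ∀ m : ℕ, N ≤ m →
      ∃ α : Fin n → ℕ, m = ∑ i, α i * h i ∧
        ((α ⟨0, hn⟩ * h ⟨0, hn⟩ : ℕ) : ℝ) < ε * m := by
  have hn2 : 1 < n := by
    by_contra hle
    obtain rfl : n = 1 := by omega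
    exact hnontriv (by simpa using hprim)
  set i₀ : Fin n := ⟨0, hn⟩
  set j : Fin n := ⟨1, hn2⟩
  have hij : i₀ ≠ j := by simp [i₀, j]
  obtain ⟨K, hK⟩ := exists_nat_gt ((h j * h i₀ : ℕ) / ε : ℝ)
  refine ⟨max K (h j * ∑ i, h i) + 1, by omega, fun m hm => ?_⟩
  obtain ⟨α, hα, hlt⟩ := Nat.exists_eq_sum_mul_of_gcd_eq_one h hprim j (hpos j) m (by omega)
  refine ⟨α, hα, ?_⟩
  have hKm : (K : ℝ) ≤ m := by exact_mod_cast (by omega : K ≤ m)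
  calc ((α i₀ * h i₀ : ℕ) : ℝ) ≤ (h j * h i₀ : ℕ) :=
        by exact_mod_cast Nat.mul_le_mul_right _ (hlt i₀ hij).le
    _ < ε * m := (div_lt_iff₀' hε).mp (hK.trans_le hKm)
end

section
/- Let (X, ρ) be a bounded separable metric space and let T : X → X be a bijection such that every iterate T^i (i ≥ 0) is Borel measurable with respect to ρ. Define ρ̃(x, y) = ∑_{i=0}^∞ 2^{−i} ρ(T^i x, T^i y). Then the metric space (X, ρ̃) is separable; moreover, for every fixed x ∈ X the function y ↦ ρ̃(x, y) is Borel measurable with respect to the Borel σ-algebra generated by ρ, and consequently every open ball in the metric ρ̃ is a Borel set with respect to ρ. -/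
/-- On a bounded metric space, the geometrically weighted distance to a fixed sequence is
continuous in the product topology. -/
theorem continuous_tsum_geometric_mul_dist {X : Type*} [MetricSpace X] {C : ℝ}
    (hC : ∀ x y : X, dist x y ≤ C) (z : ℕ → X) :
    Continuous fun w : ℕ → X => ∑' i : ℕ, (2 : ℝ)⁻¹ ^ i * dist (z i) (w i) := by
  have hs : Summable fun i : ℕ => (2 : ℝ)⁻¹ ^ i * C :=
    (summable_geometric_of_lt_one (by norm_num) (by norm_num)).mul_right C
  refine continuous_tsum (fun i => by fun_prop) hs fun i w => ?_
  rw [Real.norm_of_nonneg (by positivity)]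
  exact mul_le_mul_of_nonneg_left (hC _ _) (by positivity)

/-- For a bounded separable metric space `(X, ρ)` and a bijection `T` all of whose
iterates are Borel measurable, the metric `ρ̃(x,y) = ∑ 2⁻ⁱ ρ(Tⁱx, Tⁱy)` is separable;
moreover `y ↦ ρ̃(x,y)` is Borel measurable for each `x`, and hence every open
`ρ̃`-ball is Borel with respect to `ρ`. -/
theorem twisted_metric_separable_measurable (X : Type*) [MetricSpace X]
    [TopologicalSpace.SeparableSpace X] [MeasurableSpace X] [BorelSpace X]
    (C : ℝ) (hC : ∀ x y : X, dist x y ≤ C)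
    (T : X → X) (hT : Function.Bijective T)
    (hTm : ∀ i : ℕ, Measurable (T^[i])) :
    let ρt : X → X → ℝ := fun x y => ∑' i : ℕ, (2 : ℝ)⁻¹ ^ i * dist (T^[i] x) (T^[i] y)
    (∃ D : Set X, D.Countable ∧ ∀ x : X, ∀ ε : ℝ, 0 < ε → ∃ d ∈ D, ρt x d < ε) ∧
    (∀ x : X, Measurable fun y : X => ρt x y) ∧
    (∀ (x : X) (r : ℝ), MeasurableSet {y : X | ρt x y < r}) := by
  intro ρt
  have : SecondCountableTopology X := UniformSpace.secondCountable_of_separable X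
  let orbit : X → ℕ → X := fun x i => T^[i] x
  have hcont (x : X) := continuous_tsum_geometric_mul_dist hC (orbit x)
  have hmeas (x : X) : Measurable fun y : X => ρt x y :=
    (hcont x).measurable.comp (measurable_pi_lambda orbit hTm)
  refine ⟨?_, hmeas, fun x r => measurableSet_lt (hmeas x) measurable_const⟩
  obtain ⟨S, hS, hSd⟩ := TopologicalSpace.exists_countable_dense (Set.range orbit)
  refine ⟨(fun s => s.2.choose) '' S, hS.image _, fun x ε hε => ?_⟩
  let F : Set.range orbit → ℝ := fun s => ∑' i : ℕ, (2 : ℝ)⁻¹ ^ i * dist (orbit x i) (s.1 i)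
  have hF : Continuous F := (hcont x).comp continuous_subtype_val
  obtain ⟨s, hs, hsS⟩ := hSd.inter_open_nonempty {s | F s < ε}
    (isOpen_lt hF continuous_const) ⟨⟨orbit x, x, rfl⟩, by simpa [F] using hε⟩
  refine ⟨s.2.choose, ⟨s, hsS, rfl⟩, ?_⟩
  change ∑' i : ℕ, (2 : ℝ)⁻¹ ^ i * dist (orbit x i) (orbit s.2.choose i) < ε
  rw [s.2.choose_spec]
  exact hs
end

section
/- Let T be a Borel automorphism of a separable metric space X and let N ≥ 1 be an integer. Set X_N = {x ∈ X : T^k x ≠ x for all 1 ≤ k ≤ N}. Then there exists a sequence (U_j)_{j ∈ ℕ} of Borel subsets of X such that ⋃_j U_j = X_N and, for every j, the sets T^i(U_j), 0 ≤ i ≤ N, are pairwise disjoint. -/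
/-- For a Borel automorphism `T` of a separable metric space and `N ≥ 1`, the set
`X_N` of points with no period `≤ N` can be covered by countably many Borel sets
`U_j` such that for each `j` the sets `T^i(U_j)`, `0 ≤ i ≤ N`, are pairwise
disjoint. -/
theorem cover_by_full_tower_bases (X : Type*) [MetricSpace X]
    [TopologicalSpace.SeparableSpace X] [MeasurableSpace X] [BorelSpace X]
    (T : Equiv.Perm X) (hT : Measurable T) (hT' : Measurable T.symm)
    (N : ℕ) (hN : 1 ≤ N) :
    ∃ U : ℕ → Set X, (∀ j, MeasurableSet (U j)) ∧
      (⋃ j, U j) = {x : X | ∀ k : ℕ, 1 ≤ k → k ≤ N → (T ^ k) x ≠ x} ∧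
      ∀ j, ∀ i i' : ℕ, i ≤ N → i' ≤ N → i ≠ i' →
        Disjoint ((⇑T)^[i] '' U j) ((⇑T)^[i'] '' U j) := by
  rcases isEmpty_or_nonempty X with hX | hX
  · exact ⟨fun _ ↦ ∅, fun _ ↦ MeasurableSet.empty, Subsingleton.elim _ _, by simp⟩
  have : SecondCountableTopology X := UniformSpace.secondCountable_of_separable X
  have hB := TopologicalSpace.isBasis_countableBasis X
  have : Countable (TopologicalSpace.countableBasis X) :=
    (TopologicalSpace.countable_countableBasis X).to_subtype
  have : Nonempty (TopologicalSpace.countableBasis X) := by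
    obtain ⟨v, hv, -⟩ := hB.exists_subset_of_mem_open (Set.mem_univ hX.some) isOpen_univ
    exact ⟨⟨v, hv⟩⟩
  obtain ⟨c, hc⟩ := exists_surjective_nat (Fin N → TopologicalSpace.countableBasis X)
  refine ⟨fun j ↦ ⋂ k : Fin N, ((c j k : Set X) ∩ (⇑T)^[k + 1] ⁻¹' (c j k : Set X)ᶜ), ?_, ?_, ?_⟩
  · intro j
    refine MeasurableSet.iInter fun k ↦ ?_
    have hm : MeasurableSet (c j k : Set X) := (hB.isOpen (c j k).2).measurableSet
    exact hm.inter (hT.iterate _ hm.compl)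
  · ext x
    simp only [Set.mem_iUnion, Set.mem_iInter, Set.mem_inter_iff, Set.mem_preimage,
      Set.mem_compl_iff, Set.mem_ofPred_eq]
    constructor
    · rintro ⟨j, hj⟩ k hk hkN hx
      obtain ⟨m, rfl⟩ : ∃ m, k = m + 1 := ⟨k - 1, by omega⟩
      have h := hj ⟨m, hkN⟩
      rw [← Equiv.Perm.iterate_eq_pow] at hx
      exact h.2 (by simpa only [hx] using h.1)
    · intro hx
      have separate (k : Fin N) : ∃ b : TopologicalSpace.countableBasis X,
          x ∈ (b : Set X) ∧ (⇑T)^[k + 1] x ∉ (b : Set X) := by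
        have hne : x ≠ (⇑T)^[k + 1] x := by
          rw [Equiv.Perm.iterate_eq_pow]
          exact (hx (k + 1) (by omega) (by omega)).symm
        obtain ⟨v, hv, hxv, hsub⟩ := hB.exists_subset_of_mem_open
          (show x ∈ ({(⇑T)^[k + 1] x}ᶜ : Set X) from hne) isOpen_compl_singleton
        exact ⟨⟨v, hv⟩, hxv, fun h ↦ hsub h rfl⟩
      choose b hb using separate
      obtain ⟨j, rfl⟩ := hc b
      exact ⟨j, hb⟩
  · intro j
    have disjoint_of_lt (i i' : ℕ) (hi' : i' ≤ N) (hlt : i < i') :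
        Disjoint
          ((⇑T)^[i] '' ⋂ k : Fin N, ((c j k : Set X) ∩ (⇑T)^[k + 1] ⁻¹' (c j k : Set X)ᶜ))
          ((⇑T)^[i'] '' ⋂ k : Fin N, ((c j k : Set X) ∩ (⇑T)^[k + 1] ⁻¹' (c j k : Set X)ᶜ)) := by
      rw [Set.disjoint_left]
      rintro _ ⟨x, hx, rfl⟩ ⟨y, hy, hxy⟩
      obtain ⟨d, rfl⟩ := Nat.exists_eq_add_of_lt hlt
      rw [add_assoc, Function.iterate_add_apply] at hxy
      have hyx : (⇑T)^[d + 1] y = x := T.injective.iterate i hxy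
      let k : Fin N := ⟨d, by omega⟩
      have hy' := (Set.mem_iInter.1 hy k).2
      have hx' := (Set.mem_iInter.1 hx k).1
      exact hy' (show (⇑T)^[d + 1] y ∈ (c j k : Set X) from hyx ▸ hx')
    intro i i' hi hi' hne
    rcases lt_or_gt_of_ne hne with h | h
    · exact disjoint_of_lt i i' hi' h
    · exact (disjoint_of_lt i' i hi h).symm
end

section
/- Let T be a Borel automorphism of a Polish space X and let (𝔰_k)_{k ≥ 1} be a sequence of nontrivial primitive signatures. Then there exist a T-invariant Borel set X̂ ⊆ X consisting of aperiodic points of T, with μ(X̂) = 1 for every aperiodic T-invariant Borel probability measure μ on X, and a sequence (ξ_k)_{k ≥ 0} of equivalence relations on X̂ such that: (1) ξ₀ is the relation of equality; (2) each ξ_k is Borel, i.e., {(x,y) ∈ X̂ × X̂ : x ξ_k y} is a Borel set; (3) ξ_k is refined into ξ_{k+1}: x ξ_k y implies x ξ_{k+1} y; (4) for every k ≥ 0 and every x ∈ X̂, the ξ_k-equivalence class of x is a finite set of the form {T^j z : 0 ≤ j < m} for some z ∈ X̂ and m ≥ 1, and the sizes of ξ_k-classes are uniformly bounded by a constant depending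 only on k; (5) for every k ≥ 1, each ξ_k-class is a union of exactly N classes of ξ_{k−1} for some N ∈ 𝔰_k; (6) for every x ∈ X̂, the union over k of the ξ_k-classes of x is the entire T-orbit {T^j x : j ∈ ℤ} of x. -/
open MeasureTheory

/-- `n` is cut into `c` consecutive pieces with lengths in `s`; `D` collects the left endpoints. -/
def HasCuts (s : Finset ℕ) (n c : ℕ) : Prop :=
  ∃ D : Finset ℕ, D ⊆ Finset.range n ∧ D.card = c ∧ (0 < n → 0 ∈ D) ∧
    ∀ l ∈ D, ∃ h ∈ s, (l + h ∈ D ∨ l + h = n) ∧ ∀ j, 0 < j → j < h → l + j ∉ D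

lemma HasCuts.zero (s : Finset ℕ) : HasCuts s 0 0 :=
  ⟨∅, by simp⟩

lemma HasCuts.add {s : Finset ℕ} {n c h : ℕ} (H : HasCuts s n c) (hh : h ∈ s) (hpos : 0 < h) :
    HasCuts s (n + h) (c + 1) := by
  obtain ⟨D, hD, hc, h0, hn⟩ := H
  have hlt : ∀ l ∈ D, l < n := fun l hl => Finset.mem_range.1 (hD hl)
  refine ⟨insert n D, ?_, ?_, ?_, ?_⟩
  · intro l hl
    rw [Finset.mem_range]
    rcases Finset.mem_insert.1 hl with rfl | hl
    · omega
    · have := hlt l hl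
      omega
  · rw [Finset.card_insert_of_notMem fun hmem => (hlt n hmem).false, hc]
  · intro _
    rcases Nat.eq_zero_or_pos n with rfl | hn'
    · exact Finset.mem_insert_self _ _
    · exact Finset.mem_insert_of_mem (h0 hn')
  · intro l hl
    rcases Finset.mem_insert.1 hl with rfl | hl
    · refine ⟨h, hh, Or.inr rfl, fun j hj _ hmem => ?_⟩
      rcases Finset.mem_insert.1 hmem with hmem | hmem
      · omega
      · have := hlt _ hmem
        omega
    · obtain ⟨g, hg, hnext, hgap⟩ := hn l hl
      refine ⟨g, hg, Or.inl (Finset.mem_insert.2 hnext.symm), fun j hj hjg hmem => ?_⟩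
      rcases Finset.mem_insert.1 hmem with hmem | hmem
      · rcases hnext with hnext | hnext
        · have := hlt _ hnext
          omega
        · omega
      · exact hgap j hj hjg hmem

lemma HasCuts.add_mul {s : Finset ℕ} {n c h : ℕ} (H : HasCuts s n c) (hh : h ∈ s) (hpos : 0 < h)
    (q : ℕ) : HasCuts s (n + q * h) (c + q) := by
  induction q with
  | zero => simpa using H
  | succ q ih =>
    have := ih.add hh hpos
    rwa [add_assoc, ← Nat.succ_mul, add_assoc] at this

lemma exists_hasCuts_of_mem_closure {s : Finset ℕ} (hpos : ∀ h ∈ s, 0 < h) {n : ℕ}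
    (hn : n ∈ AddSubmonoid.closure (s : Set ℕ)) : ∃ c ≤ n, HasCuts s n c := by
  induction hn using AddSubmonoid.closure_induction_right with
  | zero => exact ⟨0, le_rfl, HasCuts.zero s⟩
  | add_right n _ h hh ih =>
    obtain ⟨c, hc, H⟩ := ih
    have := hpos h hh
    exact ⟨c + 1, by omega, H.add hh this⟩

/-- Every large integer is a sum of elements of a nontrivial primitive signature with
comparatively few summands. -/
lemma exists_sparse_cuts {s : Finset ℕ} (hne : s.Nonempty) (hpos : ∀ h ∈ s, 0 < h)
    (hgcd : s.gcd id = 1) (hs : s ≠ {1}) :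
    ∃ L : ℕ, ∀ n > L, ∃ c, 4 * c ≤ 3 * n ∧ HasCuts s n c := by
  obtain ⟨m, hm, hm2⟩ : ∃ m ∈ s, 2 ≤ m := by
    by_contra! hcon
    refine hs (Finset.eq_singleton_iff_nonempty_unique_mem.2 ⟨hne, fun x hx => ?_⟩)
    have := hpos x hx
    have := hcon x hx
    omega
  have hset : Nat.setGcd (s : Set ℕ) ∣ 1 := by
    rw [← hgcd]
    exact Finset.dvd_gcd fun b hb => Nat.setGcd_dvd_of_mem hb
  obtain ⟨n₀, hn₀⟩ := Nat.exists_mem_closure_of_ge (s : Set ℕ)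
  refine ⟨4 * (n₀ + m), fun n hn => ?_⟩
  obtain ⟨c, hc, H⟩ := exists_hasCuts_of_mem_closure hpos
    (hn₀ (n₀ + (n - n₀) % m) (Nat.le_add_right _ _) (hset.trans (one_dvd _)))
  have hdiv := Nat.div_add_mod (n - n₀) m
  have hmod := Nat.mod_lt (n - n₀) (show m > 0 by omega)
  refine ⟨c + (n - n₀) / m, ?_, ?_⟩
  · have : 2 * ((n - n₀) / m) ≤ m * ((n - n₀) / m) := Nat.mul_le_mul_right _ hm2
    omega
  · have := H.add_mul hm (by omega) ((n - n₀) / m)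
    rwa [mul_comm, show n₀ + (n - n₀) % m + m * ((n - n₀) / m) = n by omega] at this

lemma measurable_nat_sInf {α : Type*} [MeasurableSpace α] {p : α → ℕ → Prop}
    (hp : ∀ k, MeasurableSet {x | p x k}) : Measurable fun x => sInf {n | p x n} := by
  refine measurable_to_countable' fun n => ?_
  have : (fun x => sInf {n | p x n}) ⁻¹' {n} =
      {x | (p x n ∧ ∀ m, m < n → ¬ p x m) ∨ (n = 0 ∧ ∀ m, ¬ p x m)} := by
    ext x
    simp only [Set.mem_preimage, Set.mem_singleton_iff, Set.mem_ofPred_eq]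
    constructor
    · rintro rfl
      by_cases h : {n | p x n}.Nonempty
      · exact Or.inl ⟨Nat.sInf_mem h, fun m hm => Nat.notMem_of_lt_sInf hm⟩
      · rw [Set.not_nonempty_iff_eq_empty] at h
        exact Or.inr ⟨by rw [h, Nat.sInf_empty], fun m hm => by
          have : m ∈ {n | p x n} := hm
          rw [h] at this
          exact this⟩
    · rintro (⟨h1, h2⟩ | ⟨rfl, h⟩)
      · refine le_antisymm (Nat.sInf_le h1) (le_of_not_gt fun hlt => ?_)
        exact h2 _ hlt (Nat.sInf_mem (s := {n | p x n}) ⟨n, h1⟩)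
      · have : {n | p x n} = ∅ := Set.eq_empty_of_forall_notMem h
        rw [this, Nat.sInf_empty]
  rw [this]
  have h1 : MeasurableSet {x | ∀ m, m < n → ¬ p x m} := by
    simp only [Set.ofPred_forall]
    exact MeasurableSet.iInter fun m => MeasurableSet.iInter fun _ => (hp m).compl
  have h2 : MeasurableSet {x | ∀ m, ¬ p x m} := by
    simp only [Set.ofPred_forall]
    exact MeasurableSet.iInter fun m => (hp m).compl
  exact ((hp n).inter h1).union ((MeasurableSet.const _).inter h2)

section Perm

variable {X : Type*} (S : Equiv.Perm X)

lemma zpow_add_apply (i j : ℤ) (x : X) : (S ^ (i + j)) x = (S ^ i) ((S ^ j) x) := by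
  rw [zpow_add, Equiv.Perm.mul_apply]

lemma zpow_mem_iff {A : Set X} (hA : ∀ x, S x ∈ A ↔ x ∈ A) (i : ℤ) (x : X) :
    (S ^ i) x ∈ A ↔ x ∈ A := by
  induction i using Int.induction_on with
  | zero => simp
  | succ n ih => rw [add_comm, zpow_add_apply, zpow_one, hA, ih]
  | pred n ih => rw [← ih, ← hA, ← Equiv.Perm.mul_apply, ← zpow_one_add, add_sub_cancel]

variable [MeasurableSpace X]

lemma measurable_zpow (hS : Measurable S) (hS' : Measurable S.symm) (i : ℤ) :
    Measurable (S ^ i : Equiv.Perm X) := by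
  induction i using Int.induction_on with
  | zero => simpa using measurable_id
  | succ n ih =>
    rw [zpow_add_one, Equiv.Perm.coe_mul]
    exact ih.comp hS
  | pred n ih =>
    rw [zpow_sub_one, Equiv.Perm.coe_mul]
    exact ih.comp hS'

lemma measurable_zpow_apply (hS : Measurable S) (hS' : Measurable S.symm) {n : X → ℤ}
    (hn : Measurable n) : Measurable fun x => (S ^ n x) x := by
  have : Measurable fun p : ℤ × X => (S ^ p.1) p.2 :=
    measurable_from_prod_countable_right fun i => measurable_zpow S hS hS' i
  exact this.comp (hn.prodMk measurable_id)

/-- No point of `A` is periodic under `S`. -/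
def FreeOn (A : Set X) : Prop := ∀ x ∈ A, ∀ n : ℕ, 1 ≤ n → (S ^ (n : ℤ)) x ≠ x

end Perm

section Section

variable {X : Type*} {S : Equiv.Perm X} {A B : Set X}

lemma FreeOn.zpow_injective (hfree : FreeOn S A) {x : X} (hx : x ∈ A) {i j : ℤ}
    (h : (S ^ i) x = (S ^ j) x) : i = j := by
  wlog hij : i ≤ j generalizing i j
  · exact (this h.symm (by omega)).symm
  by_contra hne
  refine hfree x hx (j - i).toNat (by omega) ((S ^ i).injective ?_)
  rw [← zpow_add_apply, h]
  congr 2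
  omega

/-- `B` is a subset of `A` that every `S`-orbit in `A` meets both in the future and in the past. -/
structure IsSection (S : Equiv.Perm X) (A B : Set X) : Prop where
  subset : B ⊆ A
  forward : ∀ x ∈ A, ∃ n : ℕ, 1 ≤ n ∧ (S ^ (n : ℤ)) x ∈ B
  backward : ∀ x ∈ A, ∃ n : ℕ, (S ^ (-(n : ℤ))) x ∈ B

/-- The first positive time at which the orbit of `x` enters `B`. -/
noncomputable def returnTime (S : Equiv.Perm X) (B : Set X) (x : X) : ℕ :=
  sInf {n : ℕ | 1 ≤ n ∧ (S ^ (n : ℤ)) x ∈ B}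

/-- The time elapsed since the orbit of `x` last visited `B`. -/
noncomputable def elapsedTime (S : Equiv.Perm X) (B : Set X) (x : X) : ℕ :=
  sInf {n : ℕ | (S ^ (-(n : ℤ))) x ∈ B}

/-- The last visited point of `B` on the orbit of `x`. -/
noncomputable def lastVisit (S : Equiv.Perm X) (B : Set X) (x : X) : X :=
  (S ^ (-(elapsedTime S B x : ℤ))) x

lemma notMem_of_lt_returnTime {x : X} {n : ℕ} (h1 : 1 ≤ n) (hn : n < returnTime S B x) :
    (S ^ (n : ℤ)) x ∉ B :=
  fun h => Nat.notMem_of_lt_sInf hn ⟨h1, h⟩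

lemma notMem_of_lt_elapsedTime {x : X} {n : ℕ} (hn : n < elapsedTime S B x) :
    (S ^ (-(n : ℤ))) x ∉ B :=
  fun h => Nat.notMem_of_lt_sInf hn h

lemma zpow_elapsedTime_lastVisit (x : X) :
    (S ^ (elapsedTime S B x : ℤ)) (lastVisit S B x) = x := by
  rw [lastVisit, ← zpow_add_apply]
  simp

lemma returnTime_eq {x : X} {n : ℕ} (h1 : 1 ≤ n) (hn : (S ^ (n : ℤ)) x ∈ B)
    (hlt : ∀ j : ℕ, 0 < j → j < n → (S ^ (j : ℤ)) x ∉ B) : returnTime S B x = n := by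
  have hmem := Nat.sInf_mem (s := {n : ℕ | 1 ≤ n ∧ (S ^ (n : ℤ)) x ∈ B}) ⟨n, h1, hn⟩
  refine le_antisymm (Nat.sInf_le ⟨h1, hn⟩) (le_of_not_gt fun h => ?_)
  exact hlt _ hmem.1 h hmem.2

lemma elapsedTime_zpow {x : X} (hx : x ∈ B) {i : ℕ} (hi : i < returnTime S B x) :
    elapsedTime S B ((S ^ (i : ℤ)) x) = i := by
  have key : (S ^ (-(i : ℤ))) ((S ^ (i : ℤ)) x) = x := by simp
  have hmem : i ∈ {n : ℕ | (S ^ (-(n : ℤ))) ((S ^ (i : ℤ)) x) ∈ B} := by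
    rw [Set.mem_ofPred_eq, key]
    exact hx
  refine le_antisymm (Nat.sInf_le hmem) (le_of_not_gt fun h => ?_)
  have h' := Nat.sInf_mem (s := {n : ℕ | (S ^ (-(n : ℤ))) ((S ^ (i : ℤ)) x) ∈ B}) ⟨i, hmem⟩
  change (S ^ (-(elapsedTime S B ((S ^ (i : ℤ)) x) : ℤ))) ((S ^ (i : ℤ)) x) ∈ B at h'
  rw [← zpow_add_apply] at h'
  refine notMem_of_lt_returnTime (S := S) (B := B) (x := x)
    (n := i - elapsedTime S B ((S ^ (i : ℤ)) x)) (by omega) (by omega) ?_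
  rwa [show ((i - elapsedTime S B ((S ^ (i : ℤ)) x) : ℕ) : ℤ) =
    -(elapsedTime S B ((S ^ (i : ℤ)) x) : ℤ) + i by omega]

lemma lastVisit_zpow {x : X} (hx : x ∈ B) {i : ℕ} (hi : i < returnTime S B x) :
    lastVisit S B ((S ^ (i : ℤ)) x) = x := by
  rw [lastVisit, elapsedTime_zpow hx hi]
  simp

namespace IsSection

variable (hB : IsSection S A B)
include hB

lemma one_le_returnTime {x : X} (hx : x ∈ A) : 1 ≤ returnTime S B x :=
  (Nat.sInf_mem (s := {n : ℕ | 1 ≤ n ∧ (S ^ (n : ℤ)) x ∈ B}) (hB.forward x hx)).1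

lemma returnTime_mem {x : X} (hx : x ∈ A) : (S ^ (returnTime S B x : ℤ)) x ∈ B :=
  (Nat.sInf_mem (s := {n : ℕ | 1 ≤ n ∧ (S ^ (n : ℤ)) x ∈ B}) (hB.forward x hx)).2

lemma lastVisit_mem {x : X} (hx : x ∈ A) : lastVisit S B x ∈ B :=
  Nat.sInf_mem (s := {n : ℕ | (S ^ (-(n : ℤ))) x ∈ B}) (hB.backward x hx)

lemma elapsedTime_lt {x : X} (hx : x ∈ A) :
    elapsedTime S B x < returnTime S B (lastVisit S B x) := by
  by_contra! h
  have hmem := hB.lastVisit_mem hx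
  have h1 := hB.one_le_returnTime (hB.subset hmem)
  have h2 := hB.returnTime_mem (hB.subset hmem)
  set r := returnTime S B (lastVisit S B x)
  rw [lastVisit, ← zpow_add_apply] at h2
  refine notMem_of_lt_elapsedTime (S := S) (B := B) (x := x) (n := elapsedTime S B x - r)
    (by omega) ?_
  rwa [show -((elapsedTime S B x - r : ℕ) : ℤ) = r + -(elapsedTime S B x : ℤ) by omega]

lemma lastVisit_eq_iff {x w : X} (hx : x ∈ A) (hw : w ∈ B) :
    lastVisit S B x = w ↔ ∃ i < returnTime S B w, x = (S ^ (i : ℤ)) w := by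
  constructor
  · rintro rfl
    exact ⟨_, hB.elapsedTime_lt hx, (zpow_elapsedTime_lastVisit x).symm⟩
  · rintro ⟨i, hi, rfl⟩
    exact lastVisit_zpow hw hi

lemma firstReturn_injOn :
    Set.InjOn (fun w => (S ^ (returnTime S B w : ℤ)) w) B := by
  intro w hw w' hw' h
  wlog hle : returnTime S B w ≤ returnTime S B w' generalizing w w'
  · exact (this hw' hw h.symm (by omega)).symm
  simp only at h
  have h1 := hB.one_le_returnTime (hB.subset hw)
  have heq : w = (S ^ ((returnTime S B w' - returnTime S B w : ℕ) : ℤ)) w' := by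
    apply (S ^ (returnTime S B w : ℤ)).injective
    rw [h, ← zpow_add_apply]
    congr 2
    omega
  rcases hle.eq_or_lt with hle | hlt
  · rw [heq, hle]
    simp
  · refine absurd ?_ (notMem_of_lt_returnTime (S := S) (B := B) (x := w')
      (n := returnTime S B w' - returnTime S B w) (by omega) (by omega))
    rwa [← heq]

lemma firstReturn_surjOn (hA : ∀ x, S x ∈ A ↔ x ∈ A) :
    Set.SurjOn (fun w => (S ^ (returnTime S B w : ℤ)) w) B B := by
  intro u hu
  set v := (S ^ (-1 : ℤ)) u with hv
  have hvA : v ∈ A := (zpow_mem_iff S hA _ _).2 (hB.subset hu)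
  have hmem := hB.lastVisit_mem hvA
  have hlt := hB.elapsedTime_lt hvA
  have hback := zpow_elapsedTime_lastVisit (S := S) (B := B) v
  set w := lastVisit S B v
  have hu' : u = (S ^ ((elapsedTime S B v + 1 : ℕ) : ℤ)) w := by
    rw [Nat.cast_add, add_comm, zpow_add_apply, hback, hv, ← zpow_add_apply]
    simp
  refine ⟨w, hmem, ?_⟩
  rcases Nat.lt_or_ge (elapsedTime S B v + 1) (returnTime S B w) with h | h
  · exact absurd (hu' ▸ hu) (notMem_of_lt_returnTime (by omega) h)
  · change (S ^ (returnTime S B w : ℤ)) w = u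
    rw [show returnTime S B w = elapsedTime S B v + 1 by omega, ← hu']

open Classical in
/-- The first return map to a section, extended by the identity. -/
noncomputable def inducedPerm (hA : ∀ x, S x ∈ A ↔ x ∈ A) : Equiv.Perm X :=
  Equiv.ofBijective (fun x => if x ∈ B then (S ^ (returnTime S B x : ℤ)) x else x) <| by
    have hmaps : ∀ x ∈ B, (S ^ (returnTime S B x : ℤ)) x ∈ B :=
      fun x hx => hB.returnTime_mem (hB.subset hx)
    constructor
    · intro x y hxy
      by_cases hx : x ∈ B <;> by_cases hy : y ∈ B <;> simp only [hx, hy, if_true, if_false] at hxy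
      · exact hB.firstReturn_injOn hx hy hxy
      · exact absurd (hxy ▸ hmaps x hx) hy
      · exact absurd (hxy ▸ hmaps y hy) hx
      · exact hxy
    · intro y
      by_cases hy : y ∈ B
      · obtain ⟨x, hx, rfl⟩ := hB.firstReturn_surjOn hA hy
        exact ⟨x, by simp [hx]⟩
      · exact ⟨y, by simp [hy]⟩

lemma inducedPerm_apply_of_mem (hA : ∀ x, S x ∈ A ↔ x ∈ A) {x : X} (hx : x ∈ B) :
    hB.inducedPerm hA x = (S ^ (returnTime S B x : ℤ)) x := by
  simp [inducedPerm, hx]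

lemma inducedPerm_apply_of_notMem (hA : ∀ x, S x ∈ A ↔ x ∈ A) {x : X} (hx : x ∉ B) :
    hB.inducedPerm hA x = x := by
  simp [inducedPerm, hx]

lemma inducedPerm_mem_iff (hA : ∀ x, S x ∈ A ↔ x ∈ A) (x : X) :
    hB.inducedPerm hA x ∈ B ↔ x ∈ B := by
  by_cases hx : x ∈ B
  · rw [hB.inducedPerm_apply_of_mem hA hx]
    exact iff_of_true (hB.returnTime_mem (hB.subset hx)) hx
  · rw [hB.inducedPerm_apply_of_notMem hA hx]

lemma exists_inducedPerm_zpow (hA : ∀ x, S x ∈ A ↔ x ∈ A) {x : X} (hx : x ∈ B) (n : ℕ) :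
    ∃ m ≥ n, (hB.inducedPerm hA ^ (n : ℤ)) x = (S ^ (m : ℤ)) x := by
  induction n with
  | zero => exact ⟨0, le_rfl, by simp⟩
  | succ n ih =>
    obtain ⟨m, hm, h⟩ := ih
    have hmem := (zpow_mem_iff _ (hB.inducedPerm_mem_iff hA) n x).2 hx
    have hone := hB.one_le_returnTime (hB.subset hmem)
    refine ⟨returnTime S B ((hB.inducedPerm hA ^ (n : ℤ)) x) + m, by omega, ?_⟩
    rw [Nat.cast_succ, add_comm, zpow_add_apply, zpow_one, hB.inducedPerm_apply_of_mem hA hmem,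
      Nat.cast_add, zpow_add_apply, ← h]

lemma freeOn_inducedPerm (hA : ∀ x, S x ∈ A ↔ x ∈ A) (hfree : FreeOn S A) :
    FreeOn (hB.inducedPerm hA) B := by
  intro x hx n hn h
  obtain ⟨m, hm, h'⟩ := hB.exists_inducedPerm_zpow hA hx n
  exact hfree x (hB.subset hx) m (by omega) (h' ▸ h)

end IsSection

section Measurable

variable [MeasurableSpace X] (hS : Measurable S) (hS' : Measurable S.symm)
  (hB : MeasurableSet B)
include hS hS' hB

lemma measurable_returnTime : Measurable (returnTime S B) :=
  measurable_nat_sInf fun n => (MeasurableSet.const _).inter (measurable_zpow S hS hS' n hB)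

lemma measurable_elapsedTime : Measurable (elapsedTime S B) :=
  measurable_nat_sInf fun n => measurable_zpow S hS hS' (-(n : ℤ)) hB

lemma measurable_lastVisit : Measurable (lastVisit S B) :=
  measurable_zpow_apply S hS hS'
    (measurable_from_top.comp (measurable_elapsedTime hS hS' hB) : Measurable
      ((fun n : ℕ => -(n : ℤ)) ∘ elapsedTime S B))

end Measurable

end Section

section FullGroup

variable {X : Type*} [MeasurableSpace X] {S : Equiv.Perm X}

lemma measurePreserving_zpow {μ : Measure X} (hμ : MeasurePreserving S μ μ) (n : ℕ) :
    MeasurePreserving (S ^ (n : ℤ) : Equiv.Perm X) μ μ := by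
  rw [zpow_natCast, Equiv.Perm.coe_pow]
  exact hμ.iterate n

variable {φ : Equiv.Perm X} {n : X → ℕ}

omit [MeasurableSpace X] in
lemma image_eq_iUnion_of_fullGroup (hφ : ∀ x, φ x = (S ^ (n x : ℤ)) x) (E : Set X) :
    φ '' E = ⋃ k : ℕ, (S ^ (-(k : ℤ))) ⁻¹' (E ∩ n ⁻¹' {k}) := by
  ext y
  simp only [Set.mem_image, Set.mem_iUnion, Set.mem_preimage, Set.mem_inter_iff,
    Set.mem_singleton_iff]
  constructor
  · rintro ⟨x, hx, rfl⟩
    have : (S ^ (-(n x : ℤ))) (φ x) = x := by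
      rw [hφ, ← zpow_add_apply]
      simp
    exact ⟨n x, by rwa [this], by rw [this]⟩
  · rintro ⟨k, hx, hk⟩
    refine ⟨_, hx, ?_⟩
    rw [hφ, hk, ← zpow_add_apply]
    simp

variable (hS : Measurable S) (hS' : Measurable S.symm) (hn : Measurable n)
  (hφ : ∀ x, φ x = (S ^ (n x : ℤ)) x)
include hS hS' hn hφ

lemma measurable_of_fullGroup : Measurable φ := by
  have : (φ : X → X) = fun x => (S ^ (n x : ℤ)) x := funext hφ
  rw [this]
  exact measurable_zpow_apply S hS hS'
    (measurable_from_top.comp hn : Measurable ((fun k : ℕ => (k : ℤ)) ∘ n))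

lemma measurable_symm_of_fullGroup : Measurable φ.symm := by
  intro E hE
  rw [← Equiv.image_eq_preimage_symm, image_eq_iUnion_of_fullGroup hφ]
  exact MeasurableSet.iUnion fun k =>
    measurable_zpow S hS hS' _ (hE.inter (hn (measurableSet_singleton k)))

lemma measurePreserving_of_fullGroup {μ : Measure X} (hμ : MeasurePreserving S μ μ) :
    MeasurePreserving φ μ μ := by
  have hφm := measurable_of_fullGroup hS hS' hn hφ
  refine ⟨hφm, Measure.ext fun E hE => ?_⟩
  rw [Measure.map_apply hφm hE]
  set F := φ ⁻¹' E with hF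
  have hFm : MeasurableSet F := hφm hE
  have hFn : ∀ k, MeasurableSet (F ∩ n ⁻¹' {k}) := fun k =>
    hFm.inter (hn (measurableSet_singleton k))
  have hEF : φ '' F = E := φ.image_preimage E
  have hdisj : Pairwise (Function.onFun Disjoint fun k : ℕ => F ∩ n ⁻¹' {k}) := by
    intro i j hij
    refine Set.disjoint_left.2 fun x hx hx' => hij ?_
    exact hx.2.symm.trans hx'.2
  have hdisj' : Pairwise (Function.onFun Disjoint
      fun k : ℕ => (S ^ (-(k : ℤ))) ⁻¹' (F ∩ n ⁻¹' {k})) := by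
    have himg : ∀ (k : ℕ) (y : X), (S ^ (-(k : ℤ))) y ∈ F ∩ n ⁻¹' {k} →
        (S ^ (-(k : ℤ))) y = φ.symm y := by
      intro k y hy
      rw [Equiv.eq_symm_apply, hφ, show n _ = k from hy.2, ← zpow_add_apply]
      simp
    intro i j hij
    refine Set.disjoint_left.2 fun y hy hy' => hij ?_
    have h1 := himg i y hy
    have h2 := himg j y hy'
    exact (show n _ = i from hy.2).symm.trans (by rw [h1, ← h2]; exact hy'.2)
  have hcover : F = ⋃ k : ℕ, F ∩ n ⁻¹' {k} := by
    ext x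
    simp
  rw [← hEF, image_eq_iUnion_of_fullGroup hφ, measure_iUnion hdisj'
    fun k => measurable_zpow S hS hS' _ (hFn k)]
  conv_lhs => rw [hcover]
  rw [measure_iUnion hdisj hFn]
  refine tsum_congr fun k => ?_
  rw [← (measurePreserving_zpow hμ k).measure_preimage
    (measurable_zpow S hS hS' _ (hFn k)).nullMeasurableSet]
  congr 1
  ext x
  simp

end FullGroup

section Marker

variable {X : Type*} {S : Equiv.Perm X} {A : Set X}

/-- Greedily add the points of `B n` that are at `S`-distance more than `L` from the points
chosen before. -/
def greedyMarkers (S : Equiv.Perm X) (B : ℕ → Set X) (L : ℕ) : ℕ → Set X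
  | 0 => ∅
  | n + 1 => greedyMarkers S B L n ∪
      (B n ∩ ⋂ i : ℤ, ⋂ _ : |i| ≤ L, ((S ^ i) ⁻¹' greedyMarkers S B L n)ᶜ)

lemma greedyMarkers_separated {B : ℕ → Set X} {L : ℕ}
    (hB : ∀ n, ∀ x ∈ B n, ∀ i : ℕ, 1 ≤ i → i ≤ L → (S ^ (i : ℤ)) x ∉ B n) (n : ℕ) :
    ∀ x ∈ greedyMarkers S B L n, ∀ i : ℕ, 1 ≤ i → i ≤ L →
      (S ^ (i : ℤ)) x ∉ greedyMarkers S B L n := by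
  induction n with
  | zero => exact fun x hx => absurd hx (Set.notMem_empty x)
  | succ n ih =>
    rintro x (hx | ⟨hx, hx'⟩) i h1 hi (hy | ⟨hy, hy'⟩)
    · exact ih x hx i h1 hi hy
    · simp only [Set.mem_iInter] at hy'
      refine hy' (-(i : ℤ)) (by rw [abs_neg, Nat.abs_cast]; exact_mod_cast hi) ?_
      rw [Set.mem_preimage, ← zpow_add_apply]
      simpa using hx
    · simp only [Set.mem_iInter] at hx'
      exact hx' i (by rw [Nat.abs_cast]; exact_mod_cast hi) hy
    · exact hB n x hx i h1 hi hy

lemma exists_marker_s13 [TopologicalSpace X] [T1Space X] [SecondCountableTopology X]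
    [MeasurableSpace X] [OpensMeasurableSpace X] (hS : Measurable S) (hS' : Measurable S.symm)
    (hA : MeasurableSet A) (hfree : FreeOn S A) (L : ℕ) :
    ∃ M ⊆ A, MeasurableSet M ∧
      (∀ x ∈ M, ∀ i : ℕ, 1 ≤ i → i ≤ L → (S ^ (i : ℤ)) x ∉ M) ∧
      ∀ x ∈ A, ∃ i : ℤ, |i| ≤ L ∧ (S ^ i) x ∈ M := by
  obtain ⟨b, hbc, -, hb⟩ := TopologicalSpace.exists_countable_basis X
  obtain ⟨U, hU⟩ := (hbc.insert Set.univ).exists_eq_range ⟨_, Set.mem_insert _ _⟩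
  have hUo : ∀ n, IsOpen (U n) := fun n => by
    have : U n ∈ insert Set.univ b := hU ▸ Set.mem_range_self n
    rcases this with h | h
    · exact h ▸ isOpen_univ
    · exact hb.isOpen h
  let B : ℕ → Set X := fun n =>
    A ∩ U n ∩ ⋂ i : ℕ, ⋂ _ : 1 ≤ i, ⋂ _ : i ≤ L, ((S ^ (i : ℤ)) ⁻¹' U n)ᶜ
  have hBm : ∀ n, MeasurableSet (B n) := fun n =>
    (hA.inter (hUo n).measurableSet).inter <| MeasurableSet.iInter fun i =>
      MeasurableSet.iInter fun _ => MeasurableSet.iInter fun _ =>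
        (measurable_zpow S hS hS' i (hUo n).measurableSet).compl
  have hBsep : ∀ n, ∀ x ∈ B n, ∀ i : ℕ, 1 ≤ i → i ≤ L → (S ^ (i : ℤ)) x ∉ B n := by
    rintro n x ⟨-, hx⟩ i h1 hi hy
    simp only [Set.mem_iInter] at hx
    exact hx i h1 hi hy.1.2
  have hBcover : ∀ x ∈ A, ∃ n, x ∈ B n := by
    intro x hx
    set F : Set X := (fun i : ℕ => (S ^ (i : ℤ)) x) '' Set.Icc 1 L with hF
    have hxF : x ∈ Fᶜ := by
      rintro ⟨i, hi, h⟩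
      exact hfree x hx i hi.1 h
    obtain ⟨u, hu, hxu, huF⟩ := hb.exists_subset_of_mem_open hxF
      ((Set.finite_Icc 1 L).image _).isClosed.isOpen_compl
    obtain ⟨n, rfl⟩ : u ∈ Set.range U := hU ▸ Set.mem_insert_of_mem _ hu
    refine ⟨n, ⟨hx, hxu⟩, ?_⟩
    simp only [Set.mem_iInter]
    exact fun i h1 hi h => huF h ⟨i, ⟨h1, hi⟩, rfl⟩
  have hmono : Monotone (greedyMarkers S B L) :=
    monotone_nat_of_le_succ fun n => Set.subset_union_left
  refine ⟨⋃ n, greedyMarkers S B L n, ?_, ?_, ?_, ?_⟩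
  · refine Set.iUnion_subset fun n => ?_
    induction n with
    | zero => exact Set.empty_subset _
    | succ n ih => exact Set.union_subset ih fun x hx => hx.1.1.1
  · refine MeasurableSet.iUnion fun n => ?_
    induction n with
    | zero => exact MeasurableSet.empty
    | succ n ih =>
      exact ih.union ((hBm n).inter <| MeasurableSet.iInter fun i =>
        MeasurableSet.iInter fun _ => (measurable_zpow S hS hS' i ih).compl)
  · intro x hx i h1 hi hy
    obtain ⟨m, hm⟩ := Set.mem_iUnion.1 hx
    obtain ⟨n, hn⟩ := Set.mem_iUnion.1 hy
    exact greedyMarkers_separated hBsep (max m n) x (hmono (le_max_left m n) hm) i h1 hi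
      (hmono (le_max_right m n) hn)
  · intro x hx
    obtain ⟨n, hn⟩ := hBcover x hx
    by_cases h : ∃ i : ℤ, |i| ≤ L ∧ (S ^ i) x ∈ greedyMarkers S B L n
    · obtain ⟨i, hi, h⟩ := h
      exact ⟨i, hi, Set.mem_iUnion.2 ⟨n, h⟩⟩
    · push Not at h
      refine ⟨0, by simp, Set.mem_iUnion.2 ⟨n + 1, Or.inr ⟨by simpa using hn, ?_⟩⟩⟩
      simp only [Set.mem_iInter]
      exact fun i hi => by simpa using h i hi

lemma exists_section_lt_returnTime [TopologicalSpace X] [T1Space X] [SecondCountableTopology X]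
    [MeasurableSpace X] [OpensMeasurableSpace X] (hS : Measurable S) (hS' : Measurable S.symm)
    (hA : MeasurableSet A) (hinv : ∀ x, S x ∈ A ↔ x ∈ A) (hfree : FreeOn S A) (L : ℕ) :
    ∃ M, IsSection S A M ∧ MeasurableSet M ∧ ∀ x ∈ M, L < returnTime S M x := by
  obtain ⟨M, hMA, hMm, hsep, hmax⟩ := exists_marker_s13 hS hS' hA hfree L
  have hM : IsSection S A M := by
    refine ⟨hMA, fun x hx => ?_, fun x hx => ?_⟩
    · obtain ⟨i, hi, h⟩ := hmax ((S ^ (L + 1 : ℤ)) x) ((zpow_mem_iff S hinv _ _).2 hx)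
      rw [← zpow_add_apply] at h
      rw [abs_le] at hi
      refine ⟨(i + (L + 1)).toNat, by omega, ?_⟩
      rwa [Int.toNat_of_nonneg (by omega)]
    · obtain ⟨i, hi, h⟩ := hmax ((S ^ (-L : ℤ)) x) ((zpow_mem_iff S hinv _ _).2 hx)
      rw [← zpow_add_apply] at h
      rw [abs_le] at hi
      refine ⟨(-(i + -L)).toNat, ?_⟩
      rwa [Int.toNat_of_nonneg (by omega), neg_neg]
  refine ⟨M, hM, hMm, fun x hx => lt_of_not_ge fun h => ?_⟩
  exact hsep x hx _ (hM.one_le_returnTime (hMA hx)) h (hM.returnTime_mem (hMA hx))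

end Marker

section SparseSection

variable {X : Type*} {S : Equiv.Perm X} {A M : Set X}

/-- Cut the towers over `M` of height `n` at the levels in `D n`. -/
def refinedSection (S : Equiv.Perm X) (A M : Set X) (D : ℕ → Finset ℕ) : Set X :=
  {v | v ∈ A ∧ elapsedTime S M v ∈ D (returnTime S M (lastVisit S M v))}

lemma zpow_mem_refinedSection_iff (hM : IsSection S A M) (hinv : ∀ x, S x ∈ A ↔ x ∈ A)
    {D : ℕ → Finset ℕ} {x : X} (hx : x ∈ M) {i : ℕ} (hi : i < returnTime S M x) :
    (S ^ (i : ℤ)) x ∈ refinedSection S A M D ↔ i ∈ D (returnTime S M x) := by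
  rw [refinedSection, Set.mem_ofPred_eq, elapsedTime_zpow hx hi, lastVisit_zpow hx hi,
    and_iff_right ((zpow_mem_iff S hinv _ _).2 (hM.subset hx))]

lemma subset_refinedSection (hM : IsSection S A M) (hinv : ∀ x, S x ∈ A ↔ x ∈ A)
    {D : ℕ → Finset ℕ} (hD : ∀ x ∈ M, 0 ∈ D (returnTime S M x)) :
    M ⊆ refinedSection S A M D := by
  intro x hx
  have := (zpow_mem_refinedSection_iff hM hinv (D := D) hx
    (hM.one_le_returnTime (hM.subset hx))).2 (hD x hx)
  simpa using this

lemma measurableSet_refinedSection [MeasurableSpace X] (hS : Measurable S)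
    (hS' : Measurable S.symm) (hA : MeasurableSet A) (hM : MeasurableSet M) (D : ℕ → Finset ℕ) :
    MeasurableSet (refinedSection S A M D) := by
  refine hA.inter ?_
  have h : Measurable fun v => (elapsedTime S M v, returnTime S M (lastVisit S M v)) :=
    (measurable_elapsedTime hS hS' hM).prodMk
      ((measurable_returnTime hS hS' hM).comp (measurable_lastVisit hS hS' hM))
  exact h (MeasurableSet.of_discrete (s := {p : ℕ × ℕ | p.1 ∈ D p.2}))

lemma measure_refinedSection_le [MeasurableSpace X] (hS : Measurable S)
    (hS' : Measurable S.symm) (hA : MeasurableSet A) (hMm : MeasurableSet M)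
    (hM : IsSection S A M) (hinv : ∀ x, S x ∈ A ↔ x ∈ A) {D : ℕ → Finset ℕ}
    (hD : ∀ x ∈ M, 4 * (D (returnTime S M x)).card ≤ 3 * returnTime S M x)
    {μ : Measure X} (hμ : MeasurePreserving S μ μ) :
    4 * μ (refinedSection S A M D) ≤ 3 * μ A := by
  set B := refinedSection S A M D with hB
  have hBm : MeasurableSet B := measurableSet_refinedSection hS hS' hA hMm D
  let f : X → ℕ := fun v => returnTime S M (lastVisit S M v)
  have hf : Measurable f :=
    (measurable_returnTime hS hS' hMm).comp (measurable_lastVisit hS hS' hMm)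
  have hfm : ∀ n, MeasurableSet (f ⁻¹' {n}) := fun n => hf (measurableSet_singleton n)
  have hsplit : ∀ E : Set X, MeasurableSet E → μ E = ∑' n, μ (E ∩ f ⁻¹' {n}) := by
    intro E hE
    rw [← measure_iUnion _ fun n => hE.inter (hfm n), ← Set.inter_iUnion,
      ← Set.preimage_iUnion, Set.iUnion_of_singleton, Set.preimage_univ, Set.inter_univ]
    intro i j hij
    exact Set.disjoint_left.2 fun x hx hx' => hij (hx.2.symm.trans hx'.2)
  rw [hsplit B hBm, hsplit A hA, ← ENNReal.tsum_mul_left, ← ENNReal.tsum_mul_left]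
  refine ENNReal.tsum_le_tsum fun n => ?_
  set E : Set X := M ∩ returnTime S M ⁻¹' {n} with hE
  have hEm : MeasurableSet E :=
    hMm.inter (measurable_returnTime hS hS' hMm (measurableSet_singleton n))
  have hlevel : ∀ l : ℕ, μ ((S ^ (-(l : ℤ))) ⁻¹' E) = μ E := by
    intro l
    rw [← (measurePreserving_zpow hμ l).measure_preimage
      (measurable_zpow S hS hS' _ hEm).nullMeasurableSet]
    congr 1
    ext x
    simp
  have hBn : μ (B ∩ f ⁻¹' {n}) ≤ (D n).card * μ E := by
    have hsub : B ∩ f ⁻¹' {n} ⊆ ⋃ l ∈ D n, (S ^ (-(l : ℤ))) ⁻¹' E := by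
      rintro v ⟨⟨hv, hvD⟩, hn⟩
      refine Set.mem_biUnion (x := elapsedTime S M v) ?_ ⟨hM.lastVisit_mem hv, hn⟩
      rw [← show f v = n from hn]
      exact hvD
    calc μ (B ∩ f ⁻¹' {n}) ≤ μ (⋃ l ∈ D n, (S ^ (-(l : ℤ))) ⁻¹' E) := measure_mono hsub
      _ ≤ ∑ l ∈ D n, μ ((S ^ (-(l : ℤ))) ⁻¹' E) := measure_biUnion_finset_le _ _
      _ = (D n).card * μ E := by
        rw [Finset.sum_congr rfl fun l _ => hlevel l]
        simp
  have hlevel_mem : ∀ l < n, ∀ v ∈ (S ^ (-(l : ℤ))) ⁻¹' E,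
      v ∈ A ∧ f v = n ∧ elapsedTime S M v = l := by
    intro l hl v hv
    obtain ⟨x, hx⟩ : ∃ x, x = (S ^ (-(l : ℤ))) v := ⟨_, rfl⟩
    have hvx : v = (S ^ (l : ℤ)) x := by simp [hx]
    rw [Set.mem_preimage, ← hx] at hv
    have hlt : l < returnTime S M x := by
      rw [show returnTime S M x = n from hv.2]
      exact hl
    rw [hvx]
    refine ⟨(zpow_mem_iff S hinv _ _).2 (hM.subset hv.1), ?_, elapsedTime_zpow hv.1 hlt⟩
    change returnTime S M (lastVisit S M _) = n
    rw [lastVisit_zpow hv.1 hlt]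
    exact hv.2
  have hAn : n * μ E ≤ μ (A ∩ f ⁻¹' {n}) := by
    have hsub : ⋃ l ∈ Finset.range n, (S ^ (-(l : ℤ))) ⁻¹' E ⊆ A ∩ f ⁻¹' {n} := by
      refine Set.iUnion₂_subset fun l hl v hv => ?_
      obtain ⟨h1, h2, -⟩ := hlevel_mem l (Finset.mem_range.1 hl) v hv
      exact ⟨h1, h2⟩
    refine le_trans (le_of_eq ?_) (measure_mono hsub)
    rw [measure_biUnion_finset _ fun l _ => measurable_zpow S hS hS' _ hEm]
    · rw [Finset.sum_congr rfl fun l _ => hlevel l]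
      simp
    · intro i hi j hj hij
      refine Set.disjoint_left.2 fun v hv hv' => hij ?_
      rw [← (hlevel_mem i (by simpa using hi) v hv).2.2,
        (hlevel_mem j (by simpa using hj) v hv').2.2]
  rcases E.eq_empty_or_nonempty with h0 | ⟨x, hxM, hxn⟩
  · rw [h0, measure_empty, mul_zero] at hBn
    rw [le_antisymm hBn zero_le, mul_zero]
    exact zero_le
  · have hcard := hD x hxM
    rw [show returnTime S M x = n from hxn] at hcard
    calc 4 * μ (B ∩ f ⁻¹' {n}) ≤ 4 * ((D n).card * μ E) := by gcongr
      _ = ((4 * (D n).card : ℕ) : ENNReal) * μ E := by push_cast; ring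
      _ ≤ ((3 * n : ℕ) : ENNReal) * μ E := by gcongr
      _ = 3 * (n * μ E) := by push_cast; ring
      _ ≤ 3 * μ (A ∩ f ⁻¹' {n}) := by gcongr

/-- A section with all return times in a given nontrivial primitive signature, of relative
measure at most `3 / 4`. -/
lemma exists_sparse_section [TopologicalSpace X] [T1Space X] [SecondCountableTopology X]
    [MeasurableSpace X] [OpensMeasurableSpace X] (hS : Measurable S) (hS' : Measurable S.symm)
    (hA : MeasurableSet A) (hinv : ∀ x, S x ∈ A ↔ x ∈ A) (hfree : FreeOn S A)
    {s : Finset ℕ} (hne : s.Nonempty) (hpos : ∀ h ∈ s, 0 < h) (hgcd : s.gcd id = 1)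
    (hs : s ≠ {1}) :
    ∃ B, IsSection S A B ∧ MeasurableSet B ∧ (∀ w ∈ B, returnTime S B w ∈ s) ∧
      ∀ μ : Measure X, MeasurePreserving S μ μ → 4 * μ B ≤ 3 * μ A := by
  obtain ⟨L, hL⟩ := exists_sparse_cuts hne hpos hgcd hs
  choose! c hc D hDsub hDcard hD0 hDnext using hL
  obtain ⟨M, hM, hMm, hML⟩ := exists_section_lt_returnTime hS hS' hA hinv hfree L
  have hMB : M ⊆ refinedSection S A M D :=
    subset_refinedSection hM hinv fun x hx => hD0 _ (hML x hx) (by have := hML x hx; omega)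
  refine ⟨refinedSection S A M D, ⟨fun x hx => hx.1, fun x hx => ?_, fun x hx => ?_⟩,
    measurableSet_refinedSection hS hS' hA hMm D, fun w hw => ?_, fun μ hμ => ?_⟩
  · obtain ⟨n, h1, hn⟩ := hM.forward x hx
    exact ⟨n, h1, hMB hn⟩
  · obtain ⟨n, hn⟩ := hM.backward x hx
    exact ⟨n, hMB hn⟩
  · obtain ⟨hwA, hwD⟩ := hw
    have hx := hM.lastVisit_mem hwA
    have hlt := hM.elapsedTime_lt hwA
    have hw' := zpow_elapsedTime_lastVisit (S := S) (B := M) w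
    set x := lastVisit S M w
    set l := elapsedTime S M w
    obtain ⟨h, hh, hnext, hgap⟩ := hDnext _ (hML x hx) l hwD
    have hDlt : ∀ i ∈ D (returnTime S M x), i < returnTime S M x := fun i hi =>
      Finset.mem_range.1 (hDsub _ (hML x hx) hi)
    have hshift : ∀ j : ℕ, (S ^ (j : ℤ)) w = (S ^ ((l + j : ℕ) : ℤ)) x := by
      intro j
      rw [← hw', ← zpow_add_apply, Nat.cast_add, add_comm]
    rw [returnTime_eq (hpos h hh)]
    · exact hh
    · rw [hshift]
      rcases hnext with hnext | hnext
      · exact (zpow_mem_refinedSection_iff hM hinv hx (hDlt _ hnext)).2 hnext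
      · rw [hnext]
        exact hMB (hM.returnTime_mem (hM.subset hx))
    · intro j hj hjh
      have : l + j < returnTime S M x := by
        rcases hnext with hnext | hnext
        · have := hDlt _ hnext
          omega
        · omega
      rw [hshift, zpow_mem_refinedSection_iff hM hinv hx this]
      exact hgap j hj hjh
  · refine measure_refinedSection_le hS hS' hA hMm hM hinv (fun x hx => ?_) hμ
    rw [hDcard _ (hML x hx)]
    exact hc _ (hML x hx)

end SparseSection

section Stage

lemma lt_sum_range_iff (h : ℕ → ℕ) (n j : ℕ) :
    j < ∑ l ∈ Finset.range n, h l ↔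
      ∃ i < n, ∃ k < h i, j = k + ∑ l ∈ Finset.range i, h l := by
  induction n with
  | zero => simp
  | succ n ih =>
    rw [Finset.sum_range_succ]
    constructor
    · intro hj
      rcases Nat.lt_or_ge j (∑ l ∈ Finset.range n, h l) with hlt | hge
      · obtain ⟨i, hi, H⟩ := ih.1 hlt
        exact ⟨i, by omega, H⟩
      · exact ⟨n, by omega, j - ∑ l ∈ Finset.range n, h l, by omega, by omega⟩
    · rintro ⟨i, hi, k, hk, rfl⟩
      rcases Nat.lt_succ_iff_lt_or_eq.1 hi with hlt | rfl
      · have := ih.2 ⟨i, hlt, k, hk, rfl⟩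
        omega
      · omega

variable {X : Type*}

/-- The set of aperiodic points of `T`. -/
def aperiodicSet (T : Equiv.Perm X) : Set X := {x | ∀ k : ℕ, 1 ≤ k → (T ^ k) x ≠ x}

lemma freeOn_aperiodicSet (T : Equiv.Perm X) : FreeOn T (aperiodicSet T) := by
  intro x hx n hn
  rw [zpow_natCast]
  exact hx n hn

lemma apply_mem_aperiodicSet_iff (T : Equiv.Perm X) (x : X) :
    T x ∈ aperiodicSet T ↔ x ∈ aperiodicSet T := by
  refine forall₂_congr fun k _ => not_congr ?_
  rw [← Equiv.Perm.mul_apply, ← pow_succ, pow_succ', Equiv.Perm.mul_apply, T.injective.eq_iff]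

variable [MeasurableSpace X]

/-- One level of a filtration: a decomposition of the aperiodic points of `T` into orbit
intervals, given by the set `base` of left endpoints, the map `proj` sending a point to the left
endpoint of its interval, the lengths `height`, and the map `map` between consecutive intervals. -/
structure FiltrationStage (T : Equiv.Perm X) where
  base : Set X
  map : Equiv.Perm X
  proj : X → X
  height : X → ℕ
  measurableSet_base : MeasurableSet base
  measurable_map : Measurable map
  measurable_map_symm : Measurable map.symm
  measurable_proj : Measurable proj
  map_mem_iff : ∀ x, map x ∈ base ↔ x ∈ base
  freeOn : FreeOn map base
  measurePreserving : ∀ μ : Measure X, MeasurePreserving T μ μ → MeasurePreserving map μ μ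
  base_subset : base ⊆ aperiodicSet T
  proj_mem : ∀ x ∈ aperiodicSet T, proj x ∈ base
  proj_eq_iff : ∀ v ∈ base, ∀ y ∈ aperiodicSet T,
    proj y = v ↔ ∃ j < height v, y = (T ^ (j : ℤ)) v
  map_apply : ∀ v ∈ base, map v = (T ^ (height v : ℤ)) v
  one_le_height : ∀ v ∈ base, 1 ≤ height v
  exists_height_le : ∃ C, ∀ v ∈ base, height v ≤ C

namespace FiltrationStage

variable {T : Equiv.Perm X}

lemma proj_self (F : FiltrationStage T) {v : X} (hv : v ∈ F.base) : F.proj v = v :=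
  (F.proj_eq_iff v hv v (F.base_subset hv)).2 ⟨0, F.one_le_height v hv, by simp⟩

lemma map_zpow_apply (F : FiltrationStage T) {w : X} (hw : w ∈ F.base) (i : ℕ) :
    (F.map ^ (i : ℤ)) w =
      (T ^ ((∑ l ∈ Finset.range i, F.height ((F.map ^ (l : ℤ)) w) : ℕ) : ℤ)) w := by
  induction i with
  | zero => simp
  | succ i ih =>
    have hmem := (zpow_mem_iff F.map F.map_mem_iff i w).2 hw
    rw [Nat.cast_succ, add_comm, zpow_add_apply, zpow_one, F.map_apply _ hmem,
      Finset.sum_range_succ, Nat.cast_add, add_comm, zpow_add_apply, ← ih]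

/-- The decomposition into single points. -/
def initial (hT : Measurable T) (hT' : Measurable T.symm)
    (hm : MeasurableSet (aperiodicSet T)) : FiltrationStage T where
  base := aperiodicSet T
  map := T
  proj := id
  height := fun _ => 1
  measurableSet_base := hm
  measurable_map := hT
  measurable_map_symm := hT'
  measurable_proj := measurable_id
  map_mem_iff := apply_mem_aperiodicSet_iff T
  freeOn := freeOn_aperiodicSet T
  measurePreserving := fun _ h => h
  base_subset := Set.Subset.rfl
  proj_mem := fun _ h => h
  proj_eq_iff := fun v _ y _ => by simp
  map_apply := fun v _ => by simp
  one_le_height := fun _ _ => le_rfl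
  exists_height_le := ⟨1, fun _ _ => le_rfl⟩

/-- Each interval of `G` consists of `N` consecutive intervals of `F` with `N ∈ s`, and the
left endpoints of `G` have relative measure at most `3 / 4` among those of `F`. -/
structure Refines (s : Finset ℕ) (F G : FiltrationStage T) : Prop where
  base_subset : G.base ⊆ F.base
  exists_count : ∀ w ∈ G.base, ∃ N ∈ s, ∀ y ∈ aperiodicSet T,
    G.proj y = w ↔ ∃ i < N, F.proj y = (F.map ^ (i : ℤ)) w
  proj_congr : ∀ x y, F.proj x = F.proj y → G.proj x = G.proj y
  measure_le : ∀ μ : Measure X, MeasurePreserving T μ μ → 4 * μ G.base ≤ 3 * μ F.base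

open Classical in
lemma exists_refines [TopologicalSpace X] [T1Space X] [SecondCountableTopology X]
    [OpensMeasurableSpace X] (F : FiltrationStage T)
    {s : Finset ℕ} (hne : s.Nonempty) (hpos : ∀ h ∈ s, 0 < h) (hgcd : s.gcd id = 1)
    (hs : s ≠ {1}) : ∃ G : FiltrationStage T, Refines s F G := by
  obtain ⟨B, hB, hBm, hBs, hBμ⟩ := exists_sparse_section F.measurable_map F.measurable_map_symm
    F.measurableSet_base F.map_mem_iff F.freeOn hne hpos hgcd hs
  set φ := hB.inducedPerm F.map_mem_iff with hφ
  let n : X → ℕ := fun x => if x ∈ B then returnTime F.map B x else 0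
  have hn : Measurable n := Measurable.ite hBm
    (measurable_returnTime F.measurable_map F.measurable_map_symm hBm) measurable_const
  have hφn : ∀ x, φ x = (F.map ^ (n x : ℤ)) x := by
    intro x
    by_cases hx : x ∈ B
    · rw [hφ, hB.inducedPerm_apply_of_mem _ hx]
      simp [n, hx]
    · rw [hφ, hB.inducedPerm_apply_of_notMem _ hx]
      simp [n, hx]
  have hcount : ∀ w ∈ B, ∀ y ∈ aperiodicSet T, lastVisit F.map B (F.proj y) = w ↔
      ∃ i < returnTime F.map B w, F.proj y = (F.map ^ (i : ℤ)) w :=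
    fun w hw y hy => hB.lastVisit_eq_iff (F.proj_mem y hy) hw
  let G : FiltrationStage T :=
    { base := B
      map := φ
      proj := fun x => lastVisit F.map B (F.proj x)
      height := fun w => ∑ l ∈ Finset.range (returnTime F.map B w),
        F.height ((F.map ^ (l : ℤ)) w)
      measurableSet_base := hBm
      measurable_map := measurable_of_fullGroup F.measurable_map F.measurable_map_symm hn hφn
      measurable_map_symm :=
        measurable_symm_of_fullGroup F.measurable_map F.measurable_map_symm hn hφn
      measurable_proj := (measurable_lastVisit F.measurable_map F.measurable_map_symm hBm).comp
        F.measurable_proj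
      map_mem_iff := hB.inducedPerm_mem_iff F.map_mem_iff
      freeOn := hB.freeOn_inducedPerm F.map_mem_iff F.freeOn
      measurePreserving := fun μ hμ => measurePreserving_of_fullGroup F.measurable_map
        F.measurable_map_symm hn hφn (F.measurePreserving μ hμ)
      base_subset := hB.subset.trans F.base_subset
      proj_mem := fun x hx => hB.lastVisit_mem (F.proj_mem x hx)
      proj_eq_iff := by
        intro w hw y hy
        rw [hcount w hw y hy]
        constructor
        · rintro ⟨i, hi, hyi⟩
          have hmem := (zpow_mem_iff F.map F.map_mem_iff i w).2 (hB.subset hw)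
          obtain ⟨k, hk, rfl⟩ := (F.proj_eq_iff _ hmem y hy).1 hyi
          refine ⟨_, (lt_sum_range_iff _ _ _).2 ⟨i, hi, k, hk, rfl⟩, ?_⟩
          rw [Nat.cast_add, zpow_add_apply, ← F.map_zpow_apply (hB.subset hw)]
        · rintro ⟨j, hj, hyj⟩
          obtain ⟨i, hi, k, hk, rfl⟩ := (lt_sum_range_iff _ _ _).1 hj
          have hmem := (zpow_mem_iff F.map F.map_mem_iff i w).2 (hB.subset hw)
          refine ⟨i, hi, (F.proj_eq_iff _ hmem y hy).2 ⟨k, hk, ?_⟩⟩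
          rw [hyj, Nat.cast_add, zpow_add_apply, ← F.map_zpow_apply (hB.subset hw)]
      map_apply := fun w hw => by
        rw [hφ, hB.inducedPerm_apply_of_mem _ hw, F.map_zpow_apply (hB.subset hw)]
      one_le_height := fun w hw => by
        have h1 := F.one_le_height w (hB.subset hw)
        have h2 := Finset.single_le_sum (f := fun l : ℕ => F.height ((F.map ^ (l : ℤ)) w))
          (fun _ _ => Nat.zero_le _)
          (Finset.mem_range.2 (hB.one_le_returnTime (hB.subset hw)))
        simp only [Nat.cast_zero, zpow_zero, Equiv.Perm.one_apply] at h2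
        exact h1.trans h2
      exists_height_le := by
        obtain ⟨C, hC⟩ := F.exists_height_le
        refine ⟨s.sup id * C, fun w hw => ?_⟩
        calc ∑ l ∈ Finset.range (returnTime F.map B w), F.height ((F.map ^ (l : ℤ)) w)
            ≤ ∑ l ∈ Finset.range (returnTime F.map B w), C := Finset.sum_le_sum fun l _ =>
              hC _ ((zpow_mem_iff F.map F.map_mem_iff l w).2 (hB.subset hw))
          _ = returnTime F.map B w * C := by simp
          _ ≤ s.sup id * C :=
            Nat.mul_le_mul_right _ (Finset.le_sup (f := id) (hBs w hw)) }
  exact ⟨G, hB.subset, fun w hw => ⟨_, hBs w hw, hcount w hw⟩,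
    fun x y h => congrArg (lastVisit F.map B) h,
    fun μ hμ => hBμ μ (F.measurePreserving μ hμ)⟩

end FiltrationStage

end Stage

namespace FiltrationStage

variable {X : Type*} [MeasurableSpace X] {T : Equiv.Perm X}

lemma exists_zpow_eq (F : FiltrationStage T) {x y : X} (hx : x ∈ aperiodicSet T)
    (hy : y ∈ aperiodicSet T) (h : F.proj x = F.proj y) : ∃ j : ℤ, y = (T ^ j) x := by
  have hmem := F.proj_mem x hx
  obtain ⟨a, -, ha⟩ := (F.proj_eq_iff _ hmem x hx).1 rfl
  obtain ⟨b, -, hb⟩ := (F.proj_eq_iff _ hmem y hy).1 h.symm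
  refine ⟨b + -a, ?_⟩
  conv_lhs => rw [hb]
  conv_rhs => rw [ha, ← zpow_add_apply]
  simp

lemma apply_mem_base_of_proj_ne (F : FiltrationStage T) {x : X} (hx : x ∈ aperiodicSet T)
    (h : F.proj x ≠ F.proj (T x)) : T x ∈ F.base := by
  have hmem := F.proj_mem x hx
  obtain ⟨a, ha, hxa⟩ := (F.proj_eq_iff _ hmem x hx).1 rfl
  have hTx : T x = (T ^ ((a + 1 : ℕ) : ℤ)) (F.proj x) := by
    conv_lhs => rw [hxa]
    rw [Nat.cast_add, add_comm, zpow_add_apply, Nat.cast_one, zpow_one]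
  have hheight : F.height (F.proj x) = a + 1 := by
    by_contra hne
    exact h ((F.proj_eq_iff _ hmem _ ((apply_mem_aperiodicSet_iff T x).2 hx)).2
      ⟨a + 1, by omega, hTx⟩).symm
  rw [hTx, ← hheight, ← F.map_apply _ hmem, F.map_mem_iff]
  exact hmem

variable {F : ℕ → FiltrationStage T} {s : ℕ → Finset ℕ}

lemma proj_eq_of_le (hF : ∀ k, Refines (s k) (F k) (F (k + 1))) {x y : X} {k l : ℕ}
    (hkl : k ≤ l) (h : (F k).proj x = (F k).proj y) : (F l).proj x = (F l).proj y := by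
  induction l, hkl using Nat.le_induction with
  | base => exact h
  | succ l _ ih => exact (hF l).proj_congr x y ih

lemma exists_proj_zpow_eq (hF : ∀ k, Refines (s k) (F k) (F (k + 1))) {x : X}
    (hx : x ∈ aperiodicSet T) (hbase : ∀ j : ℤ, ∃ k, (T ^ j) x ∉ (F k).base) (n : ℕ) :
    ∃ k, (F k).proj x = (F k).proj ((T ^ (n : ℤ)) x) := by
  induction n with
  | zero => exact ⟨0, by simp⟩
  | succ n ih =>
    obtain ⟨k, hk⟩ := ih
    obtain ⟨l, hl⟩ := hbase ((n + 1 : ℕ) : ℤ)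
    rw [Nat.cast_succ, add_comm, zpow_add_apply, zpow_one] at hl ⊢
    have hstep : (F l).proj ((T ^ (n : ℤ)) x) = (F l).proj (T ((T ^ (n : ℤ)) x)) := by
      by_contra hne
      exact hl ((F l).apply_mem_base_of_proj_ne
        ((zpow_mem_iff T (apply_mem_aperiodicSet_iff T) _ _).2 hx) hne)
    exact ⟨max k l, (proj_eq_of_le hF (le_max_left k l) hk).trans
      (proj_eq_of_le hF (le_max_right k l) hstep)⟩

lemma measure_iInter_base (hF : ∀ k, Refines (s k) (F k) (F (k + 1))) {μ : Measure X}
    [IsProbabilityMeasure μ] (hμ : MeasurePreserving T μ μ) :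
    μ (⋂ k, (F k).base) = 0 := by
  have hle : ∀ k, μ (F k).base ≤ (3 / 4 : ENNReal) ^ k := by
    intro k
    induction k with
    | zero => simpa using prob_le_one
    | succ k ih =>
      have h4 : μ (F (k + 1)).base ≤ 3 * μ (F k).base / 4 := by
        rw [ENNReal.le_div_iff_mul_le (by simp) (by simp), mul_comm]
        exact (hF k).measure_le μ hμ
      calc μ (F (k + 1)).base ≤ 3 * μ (F k).base / 4 := h4
        _ ≤ 3 * (3 / 4) ^ k / 4 := by gcongr
        _ = (3 / 4) ^ (k + 1) := by
          simp only [pow_succ', div_eq_mul_inv]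
          ring
  have hlt : (3 / 4 : ENNReal) < 1 := by
    rw [ENNReal.div_lt_iff (by simp) (by simp)]
    norm_num
  refine le_antisymm (ge_of_tendsto' (ENNReal.tendsto_pow_atTop_nhds_zero_of_lt_one hlt)
    fun k => ?_) zero_le
  exact (measure_mono (Set.iInter_subset _ k)).trans (hle k)

end FiltrationStage

/-- Construction of a basic Borel filtration with a given sequence of signatures:
for a Borel automorphism `T` of a Polish space and a sequence of nontrivial
primitive signatures `s k` (`k ≥ 1`), there is a `T`-invariant Borel set `X̂` of
aperiodic points, of full measure for every aperiodic `T`-invariant Borel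
probability measure, carrying a decreasing sequence of Borel equivalence relations
`ξ k` starting from equality, with finite orbit-interval classes of uniformly
bounded size, such that each `ξ k`-class is a union of exactly `N` classes of
`ξ (k-1)` for some `N ∈ s k`, and the classes exhaust the `T`-orbits. -/
theorem basic_borel_filtration (X : Type*) [TopologicalSpace X] [PolishSpace X]
    [MeasurableSpace X] [BorelSpace X]
    (T : Equiv.Perm X) (hT : Measurable T) (hT' : Measurable T.symm)
    (s : ℕ → Finset ℕ)
    (hs : ∀ k : ℕ, 1 ≤ k →
      (s k).Nonempty ∧ (∀ h ∈ s k, 0 < h) ∧ (s k).gcd id = 1 ∧ s k ≠ {1}) :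
    ∃ Xhat : Set X, MeasurableSet Xhat ∧
      (∀ x ∈ Xhat, T x ∈ Xhat ∧ T.symm x ∈ Xhat) ∧
      (∀ x ∈ Xhat, ∀ k : ℕ, 1 ≤ k → (T ^ k) x ≠ x) ∧
      (∀ μ : Measure X, IsProbabilityMeasure μ →
        (∀ A : Set X, MeasurableSet A → μ (⇑T ⁻¹' A) = μ A) →
        μ {x : X | ∃ k : ℕ, 1 ≤ k ∧ (T ^ k) x = x} = 0 →
        μ Xhat = 1) ∧
      ∃ ξ : ℕ → X → X → Prop,
        -- the relations live on X̂
        (∀ k x y, ξ k x y → x ∈ Xhat ∧ y ∈ Xhat) ∧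
        -- each ξ k is an equivalence relation on X̂
        (∀ k, ∀ x ∈ Xhat, ξ k x x) ∧
        (∀ k x y, ξ k x y → ξ k y x) ∧
        (∀ k x y z, ξ k x y → ξ k y z → ξ k x z) ∧
        -- (1) ξ 0 is equality on X̂
        (∀ x y, ξ 0 x y ↔ x ∈ Xhat ∧ x = y) ∧
        -- (2) each ξ k is Borel
        (∀ k, MeasurableSet {p : X × X | ξ k p.1 p.2}) ∧
        -- (3) ξ k refines into ξ (k+1)
        (∀ k x y, ξ k x y → ξ (k + 1) x y) ∧
        -- (4) classes are orbit intervals of uniformly bounded size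
        (∀ k, ∃ C : ℕ, ∀ x ∈ Xhat, ∃ z : X, ∃ m : ℕ, 1 ≤ m ∧ m ≤ C ∧
          {y : X | ξ k x y} = {y : X | ∃ j : ℕ, j < m ∧ y = (T ^ j) z}) ∧
        -- (5) each ξ k-class is a union of exactly N classes of ξ (k-1), N ∈ s k
        (∀ k : ℕ, 1 ≤ k → ∀ x ∈ Xhat, ∃ N ∈ s k, ∃ z : Fin N → X,
          (∀ i, ξ k x (z i)) ∧
          (∀ i j : Fin N, i ≠ j → ¬ξ (k - 1) (z i) (z j)) ∧
          {y : X | ξ k x y} = ⋃ i : Fin N, {y : X | ξ (k - 1) (z i) y}) ∧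
        -- (6) classes exhaust the T-orbit
        (∀ x ∈ Xhat, (⋃ k : ℕ, {y : X | ξ k x y}) = {y : X | ∃ j : ℤ, y = (T ^ j) x}) := by
  have hm : MeasurableSet (aperiodicSet T) := by
    have : aperiodicSet T = ⋂ k : ℕ, ⋂ _ : 1 ≤ k, {x | (T ^ (k : ℤ)) x = x}ᶜ := by
      ext x
      simp [aperiodicSet]
    rw [this]
    exact MeasurableSet.iInter fun k => MeasurableSet.iInter fun _ =>
      (measurableSet_eq_fun (measurable_zpow T hT hT' k) measurable_id).compl
  obtain ⟨F, hF0, hF⟩ : ∃ F : ℕ → FiltrationStage T,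
      F 0 = FiltrationStage.initial hT hT' hm ∧
        ∀ k, FiltrationStage.Refines (s (k + 1)) (F k) (F (k + 1)) := by
    have hstep : ∀ (k : ℕ) (G : FiltrationStage T),
        ∃ H : FiltrationStage T, FiltrationStage.Refines (s (k + 1)) G H := fun k G =>
      have h := hs (k + 1) (Nat.le_add_left 1 k)
      G.exists_refines h.1 h.2.1 h.2.2.1 h.2.2.2
    choose next hnext using hstep
    exact ⟨fun k => Nat.rec (FiltrationStage.initial hT hT' hm) next k, rfl,
      fun k => hnext k _⟩
  set N : Set X := ⋂ k, (F k).base with hN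
  have hNm : MeasurableSet N := MeasurableSet.iInter fun k => (F k).measurableSet_base
  set Y : Set X := aperiodicSet T \ ⋃ j : ℤ, (T ^ j) ⁻¹' N with hY
  have hYm : MeasurableSet Y :=
    hm.diff (MeasurableSet.iUnion fun j => measurable_zpow T hT hT' j hNm)
  have hYinv : ∀ x, T x ∈ Y ↔ x ∈ Y := by
    intro x
    refine and_congr (apply_mem_aperiodicSet_iff T x) (not_congr ?_)
    simp only [Set.mem_iUnion, Set.mem_preimage]
    constructor
    · rintro ⟨j, h⟩
      exact ⟨j + 1, by rwa [zpow_add_apply, zpow_one]⟩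
    · rintro ⟨j, h⟩
      exact ⟨j + -1, by rw [zpow_add_apply]; simpa using h⟩
  have hYz : ∀ (j : ℤ) (x : X), (T ^ j) x ∈ Y ↔ x ∈ Y := zpow_mem_iff T hYinv
  have hYap : ∀ {x}, x ∈ Y → x ∈ aperiodicSet T := fun hx => hx.1
  have hYbase : ∀ x ∈ Y, ∀ j : ℤ, ∃ k, (T ^ j) x ∉ (F k).base := by
    intro x hx j
    by_contra! h
    exact hx.2 (Set.mem_iUnion.2 ⟨j, Set.mem_iInter.2 h⟩)
  have hclass : ∀ k, ∀ x ∈ Y, ∀ y ∈ aperiodicSet T, (F k).proj x = (F k).proj y → y ∈ Y := by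
    intro k x hx y hy h
    obtain ⟨j, rfl⟩ := (F k).exists_zpow_eq (hYap hx) hy h
    exact (hYz j x).2 hx
  have hproj : ∀ k, ∀ x ∈ Y, (F k).proj x ∈ Y := by
    intro k x hx
    have hmem := (F k).proj_mem x (hYap hx)
    exact hclass k x hx _ ((F k).base_subset hmem) ((F k).proj_self hmem).symm
  refine ⟨Y, hYm, fun x hx => ⟨(hYinv x).2 hx, ?_⟩, fun x hx => hYap hx, ?_,
    fun k x y => x ∈ Y ∧ y ∈ Y ∧ (F k).proj x = (F k).proj y, fun k x y h => ⟨h.1, h.2.1⟩,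
    fun k x hx => ⟨hx, hx, rfl⟩, fun k x y h => ⟨h.2.1, h.1, h.2.2.symm⟩,
    fun k x y z h h' => ⟨h.1, h'.2.1, h.2.2.trans h'.2.2⟩, ?_, ?_,
    fun k x y h => ⟨h.1, h.2.1, (hF k).proj_congr x y h.2.2⟩, ?_, ?_, ?_⟩
  · rw [← hYinv, Equiv.apply_symm_apply]
    exact hx
  · intro μ hμp hμ hμap
    have hμT : MeasurePreserving T μ μ :=
      ⟨hT, Measure.ext fun E hE => by rw [Measure.map_apply hT hE, hμ E hE]⟩
    have hN0 := FiltrationStage.measure_iInter_base hF hμT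
    rw [prob_compl_eq_zero_iff hYm |>.symm]
    refine measure_mono_null (t := {x : X | ∃ k : ℕ, 1 ≤ k ∧ (T ^ k) x = x} ∪
      ⋃ j : ℤ, (T ^ j) ⁻¹' N) ?_ (measure_union_null hμap (measure_iUnion_null fun j => ?_))
    · intro x hx
      by_cases h : x ∈ aperiodicSet T
      · exact Or.inr (by_contra fun h' => hx ⟨h, h'⟩)
      · left
        simpa [aperiodicSet] using h
    · have hpos : ∀ n : ℕ, μ ((T ^ (n : ℤ)) ⁻¹' N) = 0 := fun n => by
        rw [(measurePreserving_zpow hμT n).measure_preimage hNm.nullMeasurableSet, hN0]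
      obtain ⟨n, rfl | rfl⟩ := j.eq_nat_or_neg
      · exact hpos n
      · rw [← (measurePreserving_zpow hμT n).measure_preimage
          (measurable_zpow T hT hT' _ hNm).nullMeasurableSet]
        refine Eq.trans (congrArg μ ?_) hN0
        ext x
        simp [hN]
  · intro x y
    simp only [hF0, FiltrationStage.initial, id]
    constructor
    · exact fun h => ⟨h.1, h.2.2⟩
    · rintro ⟨h, rfl⟩
      exact ⟨h, h, rfl⟩
  · intro k
    have hp := (F k).measurable_proj
    exact (measurable_fst hYm).inter ((measurable_snd hYm).inter
      (measurableSet_eq_fun (hp.comp measurable_fst) (hp.comp measurable_snd)))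
  · intro k
    obtain ⟨C, hC⟩ := (F k).exists_height_le
    refine ⟨C, fun x hx => ?_⟩
    have hmem := (F k).proj_mem x (hYap hx)
    refine ⟨(F k).proj x, (F k).height ((F k).proj x), (F k).one_le_height _ hmem,
      hC _ hmem, Set.ext fun y => ⟨?_, ?_⟩⟩
    · rintro ⟨-, hy, h⟩
      simpa using ((F k).proj_eq_iff _ hmem y (hYap hy)).1 h.symm
    · rintro ⟨j, hj, rfl⟩
      have hy : (T ^ j) ((F k).proj x) ∈ Y := by
        rw [← zpow_natCast, hYz]
        exact hproj k x hx
      exact ⟨hx, hy, (((F k).proj_eq_iff _ hmem _ (hYap hy)).2 ⟨j, hj, by simp⟩).symm⟩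
  · intro k hk x hx
    obtain ⟨k, rfl⟩ : ∃ l, k = l + 1 := ⟨k - 1, by omega⟩
    rw [Nat.add_sub_cancel]
    have hmem := (F (k + 1)).proj_mem x (hYap hx)
    have hmem' := (hF k).base_subset hmem
    obtain ⟨n, hn, hcount⟩ := (hF k).exists_count _ hmem
    have hz : ∀ i : ℕ, ((F k).map ^ (i : ℤ)) ((F (k + 1)).proj x) ∈ (F k).base := fun i =>
      (zpow_mem_iff _ (F k).map_mem_iff _ _).2 hmem'
    have hzproj : ∀ i < n, (F (k + 1)).proj (((F k).map ^ (i : ℤ)) ((F (k + 1)).proj x)) =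
        (F (k + 1)).proj x := fun i hi =>
      (hcount _ ((F k).base_subset (hz i))).2 ⟨i, hi, (F k).proj_self (hz i)⟩
    have hzY : ∀ i < n, ((F k).map ^ (i : ℤ)) ((F (k + 1)).proj x) ∈ Y := fun i hi =>
      hclass (k + 1) x hx _ ((F k).base_subset (hz i)) (hzproj i hi).symm
    refine ⟨n, hn, fun i => ((F k).map ^ ((i : ℕ) : ℤ)) ((F (k + 1)).proj x),
      fun i => ⟨hx, hzY i i.2, (hzproj i i.2).symm⟩, ?_, Set.ext fun y => ?_⟩
    · rintro i j hij ⟨-, -, h⟩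
      rw [(F k).proj_self (hz i), (F k).proj_self (hz j)] at h
      have := (F k).freeOn.zpow_injective hmem' h
      exact hij (Fin.ext (by exact_mod_cast this))
    · rw [Set.mem_iUnion]
      constructor
      · rintro ⟨-, hy, h⟩
        obtain ⟨i, hi, h'⟩ := (hcount y (hYap hy)).1 h.symm
        exact ⟨⟨i, hi⟩, hzY i hi, hy, by rw [h', (F k).proj_self (hz i)]⟩
      · rintro ⟨i, -, hy, h⟩
        rw [(F k).proj_self (hz i)] at h
        exact ⟨hx, hy, ((hcount y (hYap hy)).2 ⟨i, i.2, h.symm⟩).symm⟩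
  · intro x hx
    ext y
    rw [Set.mem_iUnion]
    constructor
    · rintro ⟨k, -, hy, h⟩
      exact (F k).exists_zpow_eq (hYap hx) (hYap hy) h
    · rintro ⟨j, rfl⟩
      have hy := (hYz j x).2 hx
      obtain ⟨n, rfl | rfl⟩ := j.eq_nat_or_neg
      · obtain ⟨k, hk⟩ := FiltrationStage.exists_proj_zpow_eq hF (hYap hx) (hYbase x hx) n
        exact ⟨k, hx, hy, hk⟩
      · obtain ⟨k, hk⟩ := FiltrationStage.exists_proj_zpow_eq hF (hYap hy) (hYbase _ hy) n
        refine ⟨k, hx, hy, ?_⟩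
        rw [hk, ← zpow_add_apply]
        simp
end
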